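/- arXiv:2101.03455 — 3 statements merged into one kernel-verified Lean document; each statement's English description precedes it below -/
import Mathlib

section
/- Let r^E be a recursive tournament rule, ε ∈ [0,1/2], and let b, g, c ≥ 0 with b + g > 0 be constants such that for every pair of teams S = {u,v}, every strictly ε-bounded independent probabilistic tournament T on any number n > 1 of teams containing u and v, and every T' S-adjacent to T, the following hold for the first round of r^E: (i) Pr_{M←E(n)}[B] ≤ b; (ii) Pr_{M←E(n), M(T)}[G] ≥ g; and (iii) E_{M←E(n)}[(r^E_S(T'|_M) − r^E_S(T|_M)) · 1_B] ≤ c · Pr_{M←E(n)}[B] (i.e., the expected gain conditioned on the bad terminal event is at most c). Then α₂^{r^E}(𝒯^ε) ≤ bc/(b+g); that is, no pair of teams can gain more than bc/(b+g) by manipulating any weakly ε-bounded tournament under r^E. -/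
open scoped Classical
open Finset

/-! ## Basic tournament notions -/

/-- The set of potential matches among `n` teams: ordered pairs `(i, j)` with `i < j`. -/
abbrev MatchPair (n : ℕ) := {q : Fin n × Fin n // q.1 < q.2}

/-- A deterministic (round robin) tournament on `n` teams: for each pair `i < j`,
`true` means that `i` beats `j`. -/
abbrev Outcome (n : ℕ) := MatchPair n → Bool

/-- `Outcome.beats o i j` holds when team `i` beats team `j` (it is `false` when `i = j`). -/
def Outcome.beats {n : ℕ} (o : Outcome n) (i j : Fin n) : Bool :=
  if h : i < j then o ⟨(i, j), h⟩
  else if h' : j < i then !o ⟨(j, i), h'⟩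
  else false

/-- An independent probabilistic tournament on `n` teams: `p i j` is the probability
that `i` beats `j`, with `p i j + p j i = 1` for `i ≠ j`. -/
structure ProbTournament (n : ℕ) where
  p : Fin n → Fin n → ℝ
  mem_Icc : ∀ i j : Fin n, p i j ∈ Set.Icc (0 : ℝ) 1
  compl : ∀ i j : Fin n, i ≠ j → p i j + p j i = 1

/-- The probability of the deterministic outcome `o` when all matches are independent
with probabilities given by `T`. -/
noncomputable def ProbTournament.prob {n : ℕ} (T : ProbTournament n) (o : Outcome n) : ℝ :=
  ∏ e : MatchPair n, (if o e then T.p e.val.1 e.val.2 else T.p e.val.2 e.val.1)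

/-- `rP r T i`: the probability that team `i` wins when rule `r` is applied to the
independent probabilistic tournament `T`. -/
noncomputable def rP (r : ∀ n : ℕ, Outcome n → Fin n → ℝ) {n : ℕ}
    (T : ProbTournament n) (i : Fin n) : ℝ :=
  ∑ o : Outcome n, T.prob o * r n o i

/-- `rPS r T S`: the probability that the winner lies in `S`. -/
noncomputable def rPS (r : ∀ n : ℕ, Outcome n → Fin n → ℝ) {n : ℕ}
    (T : ProbTournament n) (S : Finset (Fin n)) : ℝ :=
  ∑ i ∈ S, rP r T i

/-- A tournament rule assigns a probability distribution over the teams to every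
deterministic tournament. -/
def IsTournamentRule (r : ∀ n : ℕ, Outcome n → Fin n → ℝ) : Prop :=
  (∀ (n : ℕ) (o : Outcome n) (i : Fin n), 0 ≤ r n o i) ∧
  (∀ n : ℕ, 0 < n → ∀ o : Outcome n, ∑ i : Fin n, r n o i = 1)

/-- A rule is Condorcet-consistent if an undefeated team wins with probability 1. -/
def CondorcetConsistent (r : ∀ n : ℕ, Outcome n → Fin n → ℝ) : Prop :=
  ∀ (n : ℕ) (o : Outcome n) (i : Fin n),
    (∀ j : Fin n, j ≠ i → Outcome.beats o i j = true) → r n o i = 1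

/-- Two independent probabilistic tournaments are `S`-adjacent if they agree on every
match that is not between two members of `S`. -/
def Adjacent {n : ℕ} (S : Finset (Fin n)) (T T' : ProbTournament n) : Prop :=
  ∀ i j : Fin n, ¬(i ∈ S ∧ j ∈ S) → T.p i j = T'.p i j

/-- Weakly ε-bounded: all match probabilities lie in `[1/2 - ε, 1/2 + ε]`. -/
def WeaklyBounded (ε : ℝ) (n : ℕ) (T : ProbTournament n) : Prop :=
  ∀ i j : Fin n, i ≠ j → T.p i j ∈ Set.Icc (1/2 - ε) (1/2 + ε)

/-- Strictly ε-bounded: all match probabilities lie in `{1/2 - ε, 1/2 + ε}`. -/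
def StrictlyBounded (ε : ℝ) (n : ℕ) (T : ProbTournament n) : Prop :=
  ∀ i j : Fin n, i ≠ j → T.p i j = 1/2 - ε ∨ T.p i j = 1/2 + ε

/-- `alph r k C`: the manipulability `α_k^r(C)`, i.e. the supremum over tournaments in the
class `C` (on any number of teams), sets `S` of at most `k` teams, and `S`-adjacent
manipulations `T'`, of the gain `r_S(T') - r_S(T)`. -/
noncomputable def alph (r : ∀ n : ℕ, Outcome n → Fin n → ℝ) (k : ℕ)
    (C : ∀ n : ℕ, ProbTournament n → Prop) : ℝ :=
  sSup {x : ℝ | ∃ (n : ℕ) (T T' : ProbTournament n) (S : Finset (Fin n)),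
    C n T ∧ S.card ≤ k ∧ Adjacent S T T' ∧ x = rPS r T' S - rPS r T S}

/-! ## Anonymity -/

/-- The relabeling of an outcome by a permutation `σ`: in `permOutcome σ o`,
team `σ i` beats team `σ j` exactly when `i` beats `j` in `o`. -/
def permOutcome {n : ℕ} (σ : Equiv.Perm (Fin n)) (o : Outcome n) : Outcome n :=
  fun e => Outcome.beats o (σ.symm e.val.1) (σ.symm e.val.2)

/-- A tournament rule is anonymous if relabeling the teams relabels the winner
distribution accordingly. -/
def IsAnonymous (r : ∀ n : ℕ, Outcome n → Fin n → ℝ) : Prop :=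
  ∀ (n : ℕ) (σ : Equiv.Perm (Fin n)) (o : Outcome n) (i : Fin n),
    r n (permOutcome σ o) (σ i) = r n o i

/-! ## Elimination rules and recursive tournament rules -/

/-- An elimination rule: for every number `n > 1` of teams, a distribution `d n` over
sets `M` of matches to be played, with `1 ≤ |M| ≤ n - 1` on the support. -/
structure ElimRule where
  d : ∀ n : ℕ, Finset (MatchPair n) → ℝ
  nonneg : ∀ (n : ℕ) (M : Finset (MatchPair n)), 0 ≤ d n M
  sum_one : ∀ n : ℕ, 1 < n → ∑ M : Finset (MatchPair n), d n M = 1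
  supp : ∀ (n : ℕ) (M : Finset (MatchPair n)), 1 < n → d n M ≠ 0 →
    1 ≤ M.card ∧ M.card ≤ n - 1

/-- A set of matches is a matching when no team appears in two distinct matches. -/
def IsMatchingSet {n : ℕ} (M : Finset (MatchPair n)) : Prop :=
  ∀ e ∈ M, ∀ e' ∈ M, e ≠ e' →
    e.val.1 ≠ e'.val.1 ∧ e.val.1 ≠ e'.val.2 ∧ e.val.2 ≠ e'.val.1 ∧ e.val.2 ≠ e'.val.2

/-- A matching elimination rule only ever selects matchings. -/
def ElimRule.IsMatchingRule (E : ElimRule) : Prop :=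
  ∀ (n : ℕ) (M : Finset (MatchPair n)), E.d n M ≠ 0 → IsMatchingSet M

/-- Team `i` loses one of the matches in `M` under the outcome `o`. -/
def losesIn {n : ℕ} (o : Outcome n) (M : Finset (MatchPair n)) (i : Fin n) : Prop :=
  ∃ e ∈ M, (e.val.1 = i ∧ Outcome.beats o e.val.2 i = true) ∨
           (e.val.2 = i ∧ Outcome.beats o e.val.1 i = true)

/-- The teams surviving the matches `M` (i.e. not losing any match of `M`). -/
noncomputable def survivors {n : ℕ} (o : Outcome n) (M : Finset (MatchPair n)) :
    Finset (Fin n) :=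
  Finset.univ.filter (fun i => ¬ losesIn o M i)

/-- The induced sub-outcome on the teams of `s`, reindexed by `Fin s.card` in
increasing order. -/
noncomputable def restrictOutcome {n : ℕ} (o : Outcome n) (s : Finset (Fin n)) :
    Outcome s.card :=
  fun e => Outcome.beats o (↑(s.orderIsoOfFin rfl e.val.1)) (↑(s.orderIsoOfFin rfl e.val.2))

/-- The induced probabilistic subtournament on the teams of `s` (same match
probabilities), reindexed by `Fin s.card` in increasing order. -/
noncomputable def restrictProb {n : ℕ} (T : ProbTournament n) (s : Finset (Fin n)) :
    ProbTournament s.card where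
  p a b := T.p ↑(s.orderIsoOfFin rfl a) ↑(s.orderIsoOfFin rfl b)
  mem_Icc _ _ := T.mem_Icc _ _
  compl a b hab := T.compl _ _
    (fun h => hab ((s.orderIsoOfFin rfl).injective (Subtype.coe_injective h)))

/-- The subset of `Fin s.card` corresponding to the members of `S` that lie in `s`. -/
noncomputable def mapTeams {n : ℕ} (s : Finset (Fin n)) (S : Finset (Fin n)) :
    Finset (Fin s.card) :=
  Finset.univ.filter (fun a => (↑(s.orderIsoOfFin rfl a) : Fin n) ∈ S)

/-- Fueled recursion computing the winner distribution of the recursive tournament rule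
`r^E`: sample `M ← E(n)`, eliminate all losers of matches in `M`, recurse on survivors. -/
noncomputable def recWinAux (E : ElimRule) : ℕ → ∀ n : ℕ, Outcome n → Fin n → ℝ
  | 0, n, _, _ => if n = 1 then 1 else 0
  | fuel + 1, n, o, i =>
    if n ≤ 1 then (if n = 1 then 1 else 0)
    else ∑ M : Finset (MatchPair n), E.d n M *
      (if h : i ∈ survivors o M then
        recWinAux E fuel (survivors o M).card (restrictOutcome o (survivors o M))
          (((survivors o M).orderIsoOfFin rfl).symm ⟨i, h⟩)
      else 0)

/-- The recursive tournament rule `r^E` determined by the elimination rule `E`. -/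
noncomputable def recWin (E : ElimRule) : ∀ n : ℕ, Outcome n → Fin n → ℝ :=
  fun n => recWinAux E n n

/-- `matchMem M u v`: the match between `u` and `v` belongs to `M`. -/
def matchMem {n : ℕ} (M : Finset (MatchPair n)) (u v : Fin n) : Prop :=
  ∃ e ∈ M, e.val = (u, v) ∨ e.val = (v, u)

/-- `valAfter r T M S`: the expected probability that the winner lies in `S` when the
matches in `M` are played with outcomes drawn from `T`, the losers are eliminated, and
`r` is then run on the induced probabilistic subtournament `T|_M` of the survivors
(with the convention that eliminated teams win with probability `0`). -/
noncomputable def valAfter (r : ∀ n : ℕ, Outcome n → Fin n → ℝ) {n : ℕ}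
    (T : ProbTournament n) (M : Finset (MatchPair n)) (S : Finset (Fin n)) : ℝ :=
  ∑ o : Outcome n, T.prob o *
    rPS r (restrictProb T (survivors o M)) (mapTeams (survivors o M) S)

/-- `U` is a base case for the manipulating coalition `S` under rule `r`:
no `S`-adjacent manipulation gains anything, i.e. `α_S^r(U) = 0`. -/
def IsBaseCase (r : ∀ n : ℕ, Outcome n → Fin n → ℝ) {m : ℕ}
    (U : ProbTournament m) (S : Finset (Fin m)) : Prop :=
  ∀ U' : ProbTournament m, Adjacent S U U' → rPS r U' S - rPS r U S ≤ 0

/-! ## Gauntlets -/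

/-- The tournament obtained from `o` by letting `u` beat every other team, keeping all
other matches intact. -/
def condorcetify {n : ℕ} (o : Outcome n) (u : Fin n) : Outcome n :=
  fun e => if e.val.1 = u then true else if e.val.2 = u then false else o e

/-- The opponents of `u` among the matches in `M`. -/
noncomputable def opponents {n : ℕ} (M : Finset (MatchPair n)) (u : Fin n) :
    Finset (Fin n) :=
  (M.filter (fun e => e.val.1 = u)).image (fun e => e.val.2) ∪
  (M.filter (fun e => e.val.2 = u)).image (fun e => e.val.1)

/-- Fueled recursion for the distribution of the gauntlet of `u`: the set of opponents
that `u` plays in elimination matches when `r^E` is executed on a tournament in which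
`u` beats everybody (the input `o` is assumed already so modified).  The value is the
probability, over the internal randomness of `E`, that the gauntlet equals `g`
(recorded as a set of teams of the outermost tournament). -/
noncomputable def gauntletDistAux (E : ElimRule) :
    ℕ → ∀ n : ℕ, Outcome n → Fin n → Finset (Fin n) → ℝ
  | 0, _, _, _, g => if g = ∅ then 1 else 0
  | fuel + 1, n, o, u, g =>
    if n ≤ 1 then (if g = ∅ then 1 else 0)
    else ∑ M : Finset (MatchPair n), E.d n M *
      (if h : u ∈ survivors o M ∧ opponents M u ⊆ g ∧ g \ opponents M u ⊆ survivors o M then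
        gauntletDistAux E fuel (survivors o M).card (restrictOutcome o (survivors o M))
          (((survivors o M).orderIsoOfFin rfl).symm ⟨u, h.1⟩)
          (Finset.univ.filter (fun a =>
            (↑((survivors o M).orderIsoOfFin rfl a) : Fin n) ∈ g \ opponents M u))
      else 0)

/-- `gauntletDist E n o u g`: the probability that the gauntlet `G^{r^E}_u(o)` of team
`u` in the deterministic tournament `o` equals the set `g`. -/
noncomputable def gauntletDist (E : ElimRule) (n : ℕ) (o : Outcome n) (u : Fin n)
    (g : Finset (Fin n)) : ℝ :=
  gauntletDistAux E n n (condorcetify o u) u g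

/-- `gauntletProbP E T u g`: the probability that the gauntlet `G^{r^E}_u(T)` of team `u`
in the independent probabilistic tournament `T` equals the set `g` (first sampling a
deterministic tournament from `T`, then the gauntlet). -/
noncomputable def gauntletProbP (E : ElimRule) {n : ℕ} (T : ProbTournament n)
    (u : Fin n) (g : Finset (Fin n)) : ℝ :=
  ∑ o : Outcome n, T.prob o * gauntletDist E n o u g

/-- Given the first-round outcome `o` and matches `M`, the probability that the gauntlet
of team `x` in the surviving probabilistic subtournament `T|_M` equals the set `g`
(where `g` is recorded with the original team labels). -/
noncomputable def gauntletEventProb (E : ElimRule) {n : ℕ} (T : ProbTournament n)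
    (M : Finset (MatchPair n)) (x : Fin n) (g : Finset (Fin n)) (o : Outcome n) : ℝ :=
  if h : x ∈ survivors o M ∧ g ⊆ survivors o M then
    gauntletProbP E (restrictProb T (survivors o M))
      (((survivors o M).orderIsoOfFin rfl).symm ⟨x, h.1⟩)
      (Finset.univ.filter (fun a =>
        (↑((survivors o M).orderIsoOfFin rfl a) : Fin n) ∈ g))
  else 0

/-! ## Randomized Death Match -/

/-- Fueled recursion for Randomized Death Match: pick one of the `n.choose 2` matches
uniformly at random, eliminate the loser, recurse. -/
noncomputable def RDMAux : ℕ → ∀ n : ℕ, Outcome n → Fin n → ℝ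
  | 0, n, _, _ => if n = 1 then 1 else 0
  | fuel + 1, n, o, i =>
    if n ≤ 1 then (if n = 1 then 1 else 0)
    else ((n.choose 2 : ℝ))⁻¹ * ∑ e : MatchPair n,
      (if h : i ∈ survivors o {e} then
        RDMAux fuel (survivors o {e}).card (restrictOutcome o (survivors o {e}))
          (((survivors o {e}).orderIsoOfFin rfl).symm ⟨i, h⟩)
      else 0)

/-- Randomized Death Match. -/
noncomputable def RDM : ∀ n : ℕ, Outcome n → Fin n → ℝ :=
  fun n => RDMAux n n

/-! ## Randomized Single Elimination Bracket -/

/-- `nextPow2 n = 2 ^ ⌈log₂ n⌉`. -/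
def nextPow2 (n : ℕ) : ℕ := 2 ^ Nat.clog 2 n

/-- Extend a tournament on `n` teams to `nextPow2 n` teams by adding dummy teams that
lose to all original teams (among themselves, the dummy with lower index wins). -/
def extendOutcome {n : ℕ} (o : Outcome n) : Outcome (nextPow2 n) :=
  fun e =>
    if h : (e.val.2 : ℕ) < n then
      Outcome.beats o ⟨(e.val.1 : ℕ), lt_trans (Fin.lt_def.mp e.2) h⟩ ⟨(e.val.2 : ℕ), h⟩
    else true

/-- Fueled recursion for Randomized Single Elimination Bracket (after dummies have been
added): pick a uniformly random maximum matching on the remaining teams, play those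
matches, eliminate all losers, recurse. -/
noncomputable def RSEBAux : ℕ → ∀ n : ℕ, Outcome n → Fin n → ℝ
  | 0, n, _, _ => if n = 1 then 1 else 0
  | fuel + 1, n, o, i =>
    if n ≤ 1 then (if n = 1 then 1 else 0)
    else
      ((Finset.univ.filter
          (fun M : Finset (MatchPair n) => IsMatchingSet M ∧ M.card = n / 2)).card : ℝ)⁻¹ *
        ∑ M ∈ Finset.univ.filter
            (fun M : Finset (MatchPair n) => IsMatchingSet M ∧ M.card = n / 2),
          (if h : i ∈ survivors o M then
            RSEBAux fuel (survivors o M).card (restrictOutcome o (survivors o M))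
              (((survivors o M).orderIsoOfFin rfl).symm ⟨i, h⟩)
          else 0)

/-- Randomized Single Elimination Bracket. -/
noncomputable def RSEB : ∀ n : ℕ, Outcome n → Fin n → ℝ :=
  fun n o i =>
    RSEBAux (nextPow2 n) (nextPow2 n) (extendOutcome o)
      (Fin.castLE (Nat.le_pow_clog one_lt_two n) i)

/-! ## Auxiliary lemmas -/

lemma aux_core0 {α β : Type} [Fintype α] [Fintype β] [DecidableEq α] [DecidableEq β] (ι : α → β) (hι : Function.Injective ι)
    (w : β → Bool → ℝ) (A : (β → Bool) → ℝ)
    (hA : ∀ o o' : β → Bool, (∀ e, e ∉ Set.range ι → o e = o' e) → A o = A o')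
    (B : (α → Bool) → ℝ) :
    ∑ o : β → Bool, (∏ e, w e (o e)) * (A o * B (o ∘ ι)) =
      (∑ y : (↥(Set.range ι)ᶜ → Bool), (∏ k, w k.1 (y k)) *
        A (fun e => if h : e ∈ (Set.range ι)ᶜ then y ⟨e, h⟩ else false)) *
      ∑ x : α → Bool, (∏ a, w (ι a) (x a)) * B x := by
  let σ : α ⊕ ↥(Set.range ι)ᶜ ≃ β :=
    (Equiv.sumCongr (Equiv.ofInjective ι hι) (Equiv.refl _)).trans
      (Equiv.Set.sumCompl (Set.range ι))
  have hσl : ∀ a, σ (Sum.inl a) = ι a := fun a => by simp [σ]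
  have hσr : ∀ k, σ (Sum.inr k) = k.1 := fun k => by simp [σ]
  let Φ : (α → Bool) × (↥(Set.range ι)ᶜ → Bool) ≃ (β → Bool) :=
    (Equiv.sumArrowEquivProdArrow _ _ _).symm.trans (Equiv.arrowCongr σ (Equiv.refl _))
  have hΦl : ∀ z a, Φ z (ι a) = z.1 a := fun z a => by
    rw [← hσl]; simp [Φ, Equiv.arrowCongr]; rfl
  have hΦr : ∀ z k, Φ z k.1 = z.2 k := fun z k => by
    rw [← hσr]; simp [Φ, Equiv.arrowCongr]; rfl
  rw [← Φ.sum_comp, Fintype.sum_prod_type, Finset.sum_mul_sum, Finset.sum_comm]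
  refine Finset.sum_congr rfl fun y _ => Finset.sum_congr rfl fun x _ => ?_
  have h1 : ∏ e, w e (Φ (x, y) e) = (∏ a, w (ι a) (x a)) * ∏ k, w k.1 (y k) := by
    rw [← σ.prod_comp, Fintype.prod_sum_type]
    congr 1
    · exact Finset.prod_congr rfl fun a _ => by rw [hσl, hΦl]
    · exact Finset.prod_congr rfl fun k _ => by
        rw [hσr]; exact congrArg _ (hΦr (x, y) k)
  have h2 : Φ (x, y) ∘ ι = x := funext fun a => hΦl _ _
  have h3 : A (Φ (x, y)) =
      A (fun e => if h : e ∈ (Set.range ι)ᶜ then y ⟨e, h⟩ else false) := by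
    apply hA
    intro e he
    have he' : e ∈ (Set.range ι)ᶜ := he
    rw [dif_pos he']
    exact hΦr (x, y) ⟨e, he'⟩
  rw [h1, h2, h3]; ring

lemma aux_sum_prod {α : Type} [Fintype α] [DecidableEq α] (w : α → Bool → ℝ)
    (hw : ∀ e, w e true + w e false = 1) : ∑ x : α → Bool, ∏ a, w a (x a) = 1 := by
  have := Finset.prod_univ_sum (fun _ : α => (Finset.univ : Finset Bool)) w
  rw [Fintype.piFinset_univ] at this
  rw [← this]
  simp [hw]

lemma aux_core {α β : Type} [Fintype α] [Fintype β] [DecidableEq α] [DecidableEq β] (ι : α → β) (hι : Function.Injective ι)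
    (w w' : β → Bool → ℝ) (hw' : ∀ e, w' e true + w' e false = 1)
    (hww : ∀ e, e ∉ Set.range ι → w e = w' e) (A : (β → Bool) → ℝ)
    (hA : ∀ o o' : β → Bool, (∀ e, e ∉ Set.range ι → o e = o' e) → A o = A o')
    (B : (α → Bool) → ℝ) :
    ∑ o : β → Bool, (∏ e, w e (o e)) * (A o * B (o ∘ ι)) =
      (∑ o : β → Bool, (∏ e, w' e (o e)) * A o) *
      ∑ x : α → Bool, (∏ a, w (ι a) (x a)) * B x := by
  have h := aux_core0 ι hι w' A hA (fun _ => 1)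
  simp only [mul_one] at h
  rw [aux_sum_prod (fun a => w' (ι a)) (fun a => hw' _), mul_one] at h
  rw [aux_core0 ι hι w A hA B, h]
  congr 1
  refine Finset.sum_congr rfl fun y _ => ?_
  congr 1
  exact Finset.prod_congr rfl fun k _ => by rw [hww _ k.2]

/-- Bernoulli weight. -/
noncomputable def auxW (x : ℝ) (b : Bool) : ℝ := if b then x else 1 - x

lemma auxW_sum (x : ℝ) : auxW x true + auxW x false = 1 := by simp [auxW]

/-- upper triangular coordinates of a tournament -/
noncomputable def auxX {n : ℕ} (T : ProbTournament n) (e : MatchPair n) : ℝ := T.p e.1.1 e.1.2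

lemma aux_prob {n : ℕ} (T : ProbTournament n) (o : Outcome n) :
    T.prob o = ∏ e, auxW (auxX T e) (o e) := by
  unfold ProbTournament.prob
  refine Finset.prod_congr rfl fun e _ => ?_
  have := T.compl e.1.1 e.1.2 (ne_of_lt e.2)
  unfold auxW auxX
  split_ifs
  · rfl
  · linarith

lemma aux_prob_nonneg {n : ℕ} (T : ProbTournament n) (o : Outcome n) : 0 ≤ T.prob o := by
  unfold ProbTournament.prob
  refine Finset.prod_nonneg fun e _ => ?_
  split_ifs
  · exact (T.mem_Icc _ _).1
  · exact (T.mem_Icc _ _).1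

lemma aux_prob_sum {n : ℕ} (T : ProbTournament n) : ∑ o, T.prob o = 1 := by
  simp only [aux_prob]
  exact aux_sum_prod _ fun e => auxW_sum _

/-! ### Survivors -/

lemma aux_beats1 {n : ℕ} (o : Outcome n) (e : MatchPair n) :
    Outcome.beats o e.1.1 e.1.2 = o e := by
  unfold Outcome.beats
  rw [dif_pos e.2]

lemma aux_beats2 {n : ℕ} (o : Outcome n) (e : MatchPair n) :
    Outcome.beats o e.1.2 e.1.1 = !o e := by
  unfold Outcome.beats
  rw [dif_neg (not_lt.2 e.2.le), dif_pos e.2]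

lemma aux_losesIn {n : ℕ} (o : Outcome n) (M : Finset (MatchPair n)) (i : Fin n) :
    losesIn o M i ↔ ∃ e ∈ M, i = if o e then e.1.2 else e.1.1 := by
  unfold losesIn
  constructor
  · rintro ⟨e, he, ⟨rfl, h⟩ | ⟨rfl, h⟩⟩
    · rw [aux_beats2] at h
      exact ⟨e, he, by simp at h; simp [h]⟩
    · rw [aux_beats1] at h
      exact ⟨e, he, by simp [h]⟩
  · rintro ⟨e, he, h⟩
    refine ⟨e, he, ?_⟩
    cases ho : o e
    · left
      simp [ho] at h
      subst h
      rw [aux_beats2]; simp [ho]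
    · right
      simp [ho] at h
      subst h
      rw [aux_beats1]; simp [ho]

lemma aux_survivors {n : ℕ} (o : Outcome n) (M : Finset (MatchPair n)) :
    survivors o M = (M.image (fun e => if o e then e.1.2 else e.1.1))ᶜ := by
  ext i
  simp only [survivors, Finset.mem_filter, Finset.mem_univ, true_and, aux_losesIn,
    Finset.mem_compl, Finset.mem_image]
  constructor
  · rintro h ⟨e, he, h'⟩; exact h ⟨e, he, h'.symm⟩
  · rintro h ⟨e, he, h'⟩; exact h ⟨e, he, h'.symm⟩

lemma aux_surv_congr {n : ℕ} (o o' : Outcome n) (M : Finset (MatchPair n))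
    (h : ∀ e ∈ M, o e = o' e) : survivors o M = survivors o' M := by
  rw [aux_survivors, aux_survivors]
  congr 1
  exact Finset.image_congr fun e he => by simp only [h e he]

lemma aux_surv_lt {n : ℕ} (o : Outcome n) (M : Finset (MatchPair n)) (h : 1 ≤ M.card) :
    (survivors o M).card < n := by
  obtain ⟨e, he⟩ := Finset.card_pos.1 h
  rw [aux_survivors]
  calc _ < (Finset.univ : Finset (Fin n)).card := by
        apply Finset.card_lt_univ_of_notMem (x := if o e then e.1.2 else e.1.1)
        rw [Finset.mem_compl, not_not]
        exact Finset.mem_image_of_mem (fun e => if o e then e.1.2 else e.1.1) he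
    _ = n := by simp

lemma aux_surv_not {n : ℕ} (o : Outcome n) (M : Finset (MatchPair n)) (e : MatchPair n)
    (he : e ∈ M) (h1 : e.1.1 ∈ survivors o M) (h2 : e.1.2 ∈ survivors o M) : False := by
  rw [aux_survivors, Finset.mem_compl] at h1 h2
  have := Finset.mem_image_of_mem (fun e => if o e then e.1.2 else e.1.1) he
  cases ho : o e
  · simp only [ho] at this; exact h1 this
  · simp only [ho] at this; exact h2 this

/-- The embedding of matches of the restriction. -/
noncomputable def auxι {n : ℕ} (s : Finset (Fin n)) (e : MatchPair s.card) : MatchPair n :=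
  ⟨(↑(s.orderIsoOfFin rfl e.1.1), ↑(s.orderIsoOfFin rfl e.1.2)),
    (s.orderIsoOfFin rfl).strictMono e.2⟩

lemma auxι_inj {n : ℕ} (s : Finset (Fin n)) : Function.Injective (auxι s) := by
  rintro ⟨⟨a, b⟩, h⟩ ⟨⟨a', b'⟩, h'⟩ hh
  simp only [auxι, Subtype.mk.injEq, Prod.mk.injEq] at hh
  obtain ⟨h1, h2⟩ := hh
  have := (s.orderIsoOfFin rfl).injective (Subtype.coe_injective h1)
  have := (s.orderIsoOfFin rfl).injective (Subtype.coe_injective h2)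
  subst_vars
  rfl

lemma aux_restrict {n : ℕ} (o : Outcome n) (s : Finset (Fin n)) :
    restrictOutcome o s = o ∘ auxι s := by
  funext e
  exact aux_beats1 o (auxι s e)

lemma aux_indep {n : ℕ} (T : ProbTournament n) (M : Finset (MatchPair n))
    (F : ∀ s : Finset (Fin n), Outcome s.card → ℝ) :
    ∑ o, T.prob o * F (survivors o M) (restrictOutcome o (survivors o M)) =
    ∑ o, T.prob o * ∑ o', (restrictProb T (survivors o M)).prob o' * F (survivors o M) o' := by
  have key : ∀ s : Finset (Fin n),
      ∑ o, T.prob o * ((if survivors o M = s then 1 else 0) * F s (restrictOutcome o s)) =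
      (∑ o, T.prob o * (if survivors o M = s then 1 else 0)) *
        ∑ o', (restrictProb T s).prob o' * F s o' := by
    intro s
    simp only [aux_restrict, aux_prob]
    refine aux_core (auxι s) (auxι_inj s) (fun e => auxW (auxX T e)) (fun e => auxW (auxX T e))
      (fun e => auxW_sum _) (fun _ _ => rfl) (fun o => if survivors o M = s then 1 else 0) ?_ (F s)
    intro o o' hoo
    by_cases hM : ∃ e ∈ M, e ∈ Set.range (auxι s)
    · obtain ⟨e, he, a, rfl⟩ := hM
      have hno : ∀ o : Outcome n, survivors o M ≠ s := by
        intro o h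
        refine aux_surv_not o M _ he ?_ ?_
        · rw [h]; exact (s.orderIsoOfFin rfl a.1.1).2
        · rw [h]; exact (s.orderIsoOfFin rfl a.1.2).2
      simp [hno]
    · push Not at hM
      have := aux_surv_congr o o' M fun e he => hoo e (hM e he)
      simp only [this]
  have h1 : ∀ o, T.prob o * F (survivors o M) (restrictOutcome o (survivors o M)) =
      ∑ s, T.prob o * ((if survivors o M = s then 1 else 0) * F s (restrictOutcome o s)) := by
    intro o
    simp [ite_mul]
  have h2 : ∀ o, T.prob o *
        ∑ o', (restrictProb T (survivors o M)).prob o' * F (survivors o M) o' =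
      ∑ s, T.prob o * (if survivors o M = s then 1 else 0) *
        ∑ o', (restrictProb T s).prob o' * F s o' := by
    intro o
    simp [ite_mul]
  simp only [h1, h2]
  rw [Finset.sum_comm, Finset.sum_comm (s := Finset.univ (α := Outcome n))]
  refine Finset.sum_congr rfl fun s _ => ?_
  rw [key s, Finset.sum_mul]

lemma aux_fuel (E : ElimRule) : ∀ (f f' m : ℕ), m ≤ f → m ≤ f' → ∀ (o : Outcome m) (i : Fin m),
    recWinAux E f m o i = recWinAux E f' m o i := by
  intro f
  induction f with
  | zero =>
    intro f' m h _ o i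
    exact absurd i.2 (by omega)
  | succ f ih =>
    intro f' m h h' o i
    cases f' with
    | zero => exact absurd i.2 (by omega)
    | succ f' =>
      unfold recWinAux
      by_cases hm : m ≤ 1
      · simp [hm]
      · rw [if_neg hm, if_neg hm]
        refine Finset.sum_congr rfl fun M _ => ?_
        by_cases hd : E.d m M = 0
        · simp [hd]
        · have := aux_surv_lt o M (E.supp m M (by omega) hd).1
          congr 1
          by_cases hi : i ∈ survivors o M
          · rw [dif_pos hi, dif_pos hi]
            exact ih f' _ (by omega) (by omega) _ _
          · rw [dif_neg hi, dif_neg hi]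

lemma aux_recWin (E : ElimRule) (n : ℕ) (hn : 1 < n) (o : Outcome n) (i : Fin n) :
    recWin E n o i = ∑ M : Finset (MatchPair n), E.d n M *
      (if h : i ∈ survivors o M then
        recWin E (survivors o M).card (restrictOutcome o (survivors o M))
          (((survivors o M).orderIsoOfFin rfl).symm ⟨i, h⟩)
      else 0) := by
  obtain ⟨k, rfl⟩ : ∃ k, n = k + 1 := ⟨n - 1, by omega⟩
  unfold recWin
  rw [recWinAux, if_neg (by omega)]
  refine Finset.sum_congr rfl fun M _ => ?_
  by_cases hd : E.d (k+1) M = 0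
  · simp [hd]
  · have := aux_surv_lt o M (E.supp (k+1) M (by omega) hd).1
    congr 1
    by_cases hi : i ∈ survivors o M
    · rw [dif_pos hi, dif_pos hi]
      exact aux_fuel E _ _ _ (by omega) (by omega) _ _
    · rw [dif_neg hi, dif_neg hi]

lemma aux_sum_map {n : ℕ} (s S : Finset (Fin n)) (f : Fin s.card → ℝ) :
    ∑ i ∈ S, (if h : i ∈ s then f ((s.orderIsoOfFin rfl).symm ⟨i, h⟩) else 0) =
    ∑ a ∈ mapTeams s S, f a := by
  symm
  refine Finset.sum_bij_ne_zero (fun a _ _ => (s.orderIsoOfFin rfl a : Fin n)) ?_ ?_ ?_ ?_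
  · intro a ha _
    exact (Finset.mem_filter.1 ha).2
  · intro a _ _ b _ _ h
    exact (s.orderIsoOfFin rfl).injective (Subtype.coe_injective h)
  · intro i hi hne
    by_cases h : i ∈ s
    · rw [dif_pos h] at hne
      refine ⟨(s.orderIsoOfFin rfl).symm ⟨i, h⟩, ?_, hne, ?_⟩
      · rw [mapTeams, Finset.mem_filter, OrderIso.apply_symm_apply]
        exact ⟨Finset.mem_univ _, hi⟩
      · rw [OrderIso.apply_symm_apply]
    · rw [dif_neg h] at hne; exact absurd rfl hne
  · intro a _ _
    rw [dif_pos (s.orderIsoOfFin rfl a).2]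
    congr 1
    exact ((s.orderIsoOfFin rfl).symm_apply_apply a).symm

lemma aux_rPS (r : ∀ n : ℕ, Outcome n → Fin n → ℝ) {n : ℕ}
    (T : ProbTournament n) (S : Finset (Fin n)) :
    rPS r T S = ∑ o, T.prob o * ∑ i ∈ S, r n o i := by
  unfold rPS rP
  rw [Finset.sum_comm]
  simp only [Finset.mul_sum]

lemma aux_decomp (E : ElimRule) {n : ℕ} (hn : 1 < n) (T : ProbTournament n)
    (S : Finset (Fin n)) :
    rPS (recWin E) T S = ∑ M, E.d n M * valAfter (recWin E) T M S := by
  have h : ∀ M, valAfter (recWin E) T M S = ∑ o, T.prob o *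
      ∑ i ∈ S, (if h : i ∈ survivors o M then
        recWin E (survivors o M).card (restrictOutcome o (survivors o M))
          (((survivors o M).orderIsoOfFin rfl).symm ⟨i, h⟩)
      else 0) := by
    intro M
    unfold valAfter
    simp only [aux_rPS]
    rw [← aux_indep T M (fun s o' => ∑ a ∈ mapTeams s S, recWin E s.card o' a)]
    refine Finset.sum_congr rfl fun o _ => ?_
    rw [aux_sum_map]
  simp only [h, aux_rPS, aux_recWin E n hn, Finset.mul_sum]
  rw [Finset.sum_comm (s := Finset.univ (α := Finset (MatchPair n)))]
  refine Finset.sum_congr rfl fun o _ => ?_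
  rw [Finset.sum_comm]
  refine Finset.sum_congr rfl fun M _ => Finset.sum_congr rfl fun i _ => ?_
  ring

lemma aux_adj_X {n : ℕ} {S : Finset (Fin n)} {T T' : ProbTournament n} (h : Adjacent S T T')
    (e : MatchPair n) (he : ¬(e.1.1 ∈ S ∧ e.1.2 ∈ S)) : auxX T e = auxX T' e :=
  h _ _ he

lemma aux_small (r : ∀ n : ℕ, Outcome n → Fin n → ℝ) {n : ℕ} (S : Finset (Fin n))
    (hS : S.card ≤ 1) (T T' : ProbTournament n) (h : Adjacent S T T') :
    rPS r T' S = rPS r T S := by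
  simp only [aux_rPS, aux_prob]
  have : ∀ e, auxX T e = auxX T' e := by
    intro e
    apply aux_adj_X h
    rintro ⟨h1, h2⟩
    exact (ne_of_lt e.2) (Finset.card_le_one.1 hS _ h1 _ h2)
  simp only [this]

lemma aux_pair {n : ℕ} (u v : Fin n) (huv : u ≠ v) :
    ∃ e0 : MatchPair n, (e0.1 = (u, v) ∨ e0.1 = (v, u)) ∧
      ∀ e : MatchPair n, e ≠ e0 →
        ¬(e.1.1 ∈ ({u, v} : Finset (Fin n)) ∧ e.1.2 ∈ ({u, v} : Finset (Fin n))) := by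
  have main : ∀ a b : Fin n, a < b → ∀ e : MatchPair n, e.1 ≠ (a, b) →
      ¬(e.1.1 ∈ ({a, b} : Finset (Fin n)) ∧ e.1.2 ∈ ({a, b} : Finset (Fin n))) := by
    rintro a b hab ⟨⟨x, y⟩, hxy⟩ hne ⟨h1, h2⟩
    simp only [Finset.mem_insert, Finset.mem_singleton] at h1 h2
    simp only [ne_eq, Prod.mk.injEq, not_and] at hne
    simp only at hxy
    rcases h1 with rfl | rfl <;> rcases h2 with rfl | rfl
    · exact lt_irrefl _ hxy
    · exact hne rfl rfl
    · exact lt_asymm hxy hab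
    · exact lt_irrefl _ hxy
  rcases lt_or_gt_of_ne huv with h | h
  · exact ⟨⟨(u, v), h⟩, Or.inl rfl, fun e he => main u v h e fun h' => he (Subtype.ext h')⟩
  · refine ⟨⟨(v, u), h⟩, Or.inr rfl, fun e he => ?_⟩
    rw [Finset.pair_comm]
    exact main v u h e fun h' => he (Subtype.ext h')

lemma aux_swap {n : ℕ} (u v : Fin n) (huv : u ≠ v) (T T' : ProbTournament n)
    (h : Adjacent {u, v} T T') (M : Finset (MatchPair n)) (hM : ¬ matchMem M u v)
    (H : Finset (Fin n) → ℝ) :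
    ∑ o, T'.prob o * H (survivors o M) = ∑ o, T.prob o * H (survivors o M) := by
  obtain ⟨e0, he0, hne⟩ := aux_pair u v huv
  have := aux_core (fun _ : Unit => e0) (fun _ _ _ => rfl) (fun e => auxW (auxX T' e))
    (fun e => auxW (auxX T e)) (fun e => auxW_sum _)
    (by
      intro e he
      rw [aux_adj_X h e (hne e fun h' => he ⟨(), h'.symm⟩)])
    (fun o => H (survivors o M))
    (by
      intro o o' hoo
      rw [aux_surv_congr o o' M]
      intro e he
      apply hoo
      rintro ⟨_, rfl⟩
      exact hM ⟨e0, he, he0⟩)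
    (fun _ => 1)
  simp only [mul_one] at this
  rw [aux_sum_prod (fun _ : Unit => auxW (auxX T' e0)) (fun _ => auxW_sum _), mul_one] at this
  simp only [aux_prob]
  exact this

lemma aux_restrict_adj {n : ℕ} (S s : Finset (Fin n)) (T T' : ProbTournament n)
    (h : Adjacent S T T') : Adjacent (mapTeams s S) (restrictProb T s) (restrictProb T' s) := by
  intro i j hij
  apply h
  rintro ⟨h1, h2⟩
  exact hij ⟨Finset.mem_filter.2 ⟨Finset.mem_univ _, h1⟩,
    Finset.mem_filter.2 ⟨Finset.mem_univ _, h2⟩⟩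

lemma aux_restrict_strict {n : ℕ} (ε : ℝ) (s : Finset (Fin n)) (T : ProbTournament n)
    (h : StrictlyBounded ε n T) : StrictlyBounded ε _ (restrictProb T s) := by
  intro i j hij
  exact h _ _ fun h' => hij ((s.orderIsoOfFin rfl).injective (Subtype.coe_injective h'))

lemma aux_mapTeams_card {n : ℕ} (s S : Finset (Fin n)) : (mapTeams s S).card ≤ S.card := by
  refine Finset.card_le_card_of_injOn (fun a => (s.orderIsoOfFin rfl a : Fin n)) ?_ ?_
  · intro a ha
    exact (Finset.mem_filter.1 ha).2
  · intro a _ b _ h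
    exact (s.orderIsoOfFin rfl).injective (Subtype.coe_injective h)

lemma aux_strict (E : ElimRule) (ε : ℝ)
    (b g c : ℝ) (hb0 : 0 ≤ b) (hg0 : 0 ≤ g) (hc0 : 0 ≤ c) (hbg : 0 < b + g)
    (hB : ∀ n : ℕ, 1 < n → ∀ u v : Fin n, u ≠ v →
      (∑ M : Finset (MatchPair n), E.d n M * (if matchMem M u v then 1 else 0)) ≤ b)
    (hG : ∀ n : ℕ, 1 < n → ∀ u v : Fin n, u ≠ v →
      ∀ T : ProbTournament n, StrictlyBounded ε n T →
      g ≤ ∑ M : Finset (MatchPair n), E.d n M *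
        (if matchMem M u v then 0 else
          ∑ o : Outcome n, T.prob o *
            (if IsBaseCase (recWin E) (restrictProb T (survivors o M))
                (mapTeams (survivors o M) {u, v}) then 1 else 0)))
    (hC : ∀ n : ℕ, 1 < n → ∀ u v : Fin n, u ≠ v →
      ∀ T T' : ProbTournament n, StrictlyBounded ε n T → Adjacent {u, v} T T' →
      (∑ M : Finset (MatchPair n), E.d n M *
          (if matchMem M u v then
            valAfter (recWin E) T' M {u, v} - valAfter (recWin E) T M {u, v} else 0))
        ≤ c * ∑ M : Finset (MatchPair n), E.d n M * (if matchMem M u v then 1 else 0)) :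
    ∀ (n : ℕ) (T T' : ProbTournament n) (S : Finset (Fin n)), StrictlyBounded ε n T →
      S.card ≤ 2 → Adjacent S T T' →
      rPS (recWin E) T' S - rPS (recWin E) T S ≤ b * c / (b + g) := by
  intro n
  have hx0 : 0 ≤ b * c / (b + g) := by positivity
  obtain ⟨x, hx⟩ : ∃ x, x = b * c / (b + g) := ⟨_, rfl⟩
  rw [← hx] at hx0 ⊢
  induction n using Nat.strong_induction_on with
  | _ n ih =>
  intro T T' S hT hS hadj
  by_cases hS1 : S.card ≤ 1
  · rw [aux_small _ S hS1 T T' hadj, sub_self]; exact hx0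
  obtain ⟨u, v, huv, rfl⟩ := Finset.card_eq_two.1 (show S.card = 2 by omega)
  have hn : 1 < n := by
    have := Finset.card_le_univ ({u, v} : Finset (Fin n))
    rw [Fintype.card_fin] at this
    omega
  have hB' := hB n hn u v huv
  have hG' := hG n hn u v huv T hT
  have hC' := hC n hn u v huv T T' hT hadj
  set PB := ∑ M : Finset (MatchPair n), E.d n M * (if matchMem M u v then (1:ℝ) else 0) with hPB
  set PG := ∑ M : Finset (MatchPair n), E.d n M *
        (if matchMem M u v then 0 else
          ∑ o : Outcome n, T.prob o *
            (if IsBaseCase (recWin E) (restrictProb T (survivors o M))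
                (mapTeams (survivors o M) {u, v}) then (1:ℝ) else 0)) with hPG
  -- rounds without the match `(u, v)`
  have hstep : ∀ M : Finset (MatchPair n), E.d n M *
      (valAfter (recWin E) T' M {u, v} - valAfter (recWin E) T M {u, v}) ≤
      E.d n M * (if matchMem M u v then
            valAfter (recWin E) T' M {u, v} - valAfter (recWin E) T M {u, v} else 0) +
      x * (E.d n M - E.d n M * (if matchMem M u v then (1:ℝ) else 0) -
        E.d n M * (if matchMem M u v then 0 else
          ∑ o : Outcome n, T.prob o *
            (if IsBaseCase (recWin E) (restrictProb T (survivors o M))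
                (mapTeams (survivors o M) {u, v}) then (1:ℝ) else 0))) := by
    intro M
    by_cases hM : matchMem M u v
    · simp [hM]
    by_cases hd : E.d n M = 0
    · simp [hd]
    simp only [hM, if_false, mul_zero, zero_add, sub_zero]
    have hlt := fun o => aux_surv_lt o M (E.supp n M hn hd).1
    have hv : valAfter (recWin E) T' M {u, v} - valAfter (recWin E) T M {u, v} ≤
        x * (1 - ∑ o : Outcome n, T.prob o *
            (if IsBaseCase (recWin E) (restrictProb T (survivors o M))
                (mapTeams (survivors o M) {u, v}) then (1:ℝ) else 0)) := by
      have e1 : valAfter (recWin E) T' M {u, v} = ∑ o : Outcome n, T.prob o *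
          rPS (recWin E) (restrictProb T' (survivors o M)) (mapTeams (survivors o M) {u, v}) :=
        aux_swap u v huv T T' hadj M hM
          (fun s => rPS (recWin E) (restrictProb T' s) (mapTeams s {u, v}))
      have e2 : ∀ f : Outcome n → ℝ,
          1 - ∑ o, T.prob o * f o = ∑ o, T.prob o * (1 - f o) := by
        intro f
        simp only [mul_sub, mul_one, Finset.sum_sub_distrib, aux_prob_sum]
      rw [e1, valAfter, ← Finset.sum_sub_distrib, e2, Finset.mul_sum]
      refine Finset.sum_le_sum fun o _ => ?_
      have hp := aux_prob_nonneg T o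
      have hadj' := aux_restrict_adj {u, v} (survivors o M) T T' hadj
      have : rPS (recWin E) (restrictProb T' (survivors o M)) (mapTeams (survivors o M) {u, v}) -
          rPS (recWin E) (restrictProb T (survivors o M)) (mapTeams (survivors o M) {u, v}) ≤
          x * (1 - if IsBaseCase (recWin E) (restrictProb T (survivors o M))
                (mapTeams (survivors o M) {u, v}) then (1:ℝ) else 0) := by
        split_ifs with hbase
        · have := hbase _ hadj'
          linarith
        · have := ih _ (hlt o) _ _ _ (aux_restrict_strict ε (survivors o M) T hT)
            ((aux_mapTeams_card _ _).trans hS) hadj'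
          linarith
      calc _ = T.prob o * _ := (mul_sub _ _ _).symm
        _ ≤ _ := mul_le_mul_of_nonneg_left this hp
        _ = _ := by ring
    calc _ ≤ _ := mul_le_mul_of_nonneg_left hv (E.nonneg n M)
      _ = _ := by ring
  have hgain : rPS (recWin E) T' {u, v} - rPS (recWin E) T {u, v} ≤
      c * PB + x * (1 - PB - PG) := by
    rw [aux_decomp E hn T', aux_decomp E hn T, ← Finset.sum_sub_distrib]
    simp only [← mul_sub]
    refine (Finset.sum_le_sum fun M _ => hstep M).trans ?_
    rw [Finset.sum_add_distrib, ← Finset.mul_sum, Finset.sum_sub_distrib,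
      Finset.sum_sub_distrib, E.sum_one n hn]
    linarith
  have hxe : x * (b + g) = b * c := by rw [hx]; field_simp
  have hxc : x ≤ c := by
    rw [hx, div_le_iff₀ hbg]
    nlinarith [mul_nonneg hc0 hg0]
  nlinarith [mul_le_mul_of_nonneg_left hB' (sub_nonneg.2 hxc), mul_le_mul_of_nonneg_left hG' hx0]

/-! ### From weakly to strictly bounded -/

lemma aux_corner {β : Type} [Fintype β] [DecidableEq β] (D : (β → ℝ) → ℝ)
    (hD : ∀ x e, ∃ a c, ∀ t, D (Function.update x e t) = a + c * t)
    (l h : ℝ) (x : β → ℝ) (hx : ∀ e, x e ∈ Set.Icc l h) :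
    ∃ y : β → ℝ, (∀ e, y e = l ∨ y e = h) ∧ D x ≤ D y := by
  have main : ∀ s : Finset β, ∃ y : β → ℝ, (∀ e, y e ∈ Set.Icc l h) ∧
      (∀ e ∈ s, y e = l ∨ y e = h) ∧ D x ≤ D y := by
    intro s
    induction s using Finset.induction_on with
    | empty => exact ⟨x, hx, by simp, le_rfl⟩
    | insert e s _ ih =>
      obtain ⟨y, hy1, hy2, hy3⟩ := ih
      obtain ⟨a, c, hac⟩ := hD y e
      have hye : D y = a + c * y e := by rw [← hac, Function.update_eq_self]
      have hlh : l ≤ h := (hy1 e).1.trans (hy1 e).2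
      have fin : ∀ t, (t = l ∨ t = h) → c * y e ≤ c * t →
          ∃ y : β → ℝ, (∀ e, y e ∈ Set.Icc l h) ∧
            (∀ e' ∈ insert e s, y e' = l ∨ y e' = h) ∧ D x ≤ D y := by
        intro t ht hle
        refine ⟨Function.update y e t, ?_, ?_, ?_⟩
        · intro e'
          by_cases hee : e' = e
          · subst hee
            rw [Function.update_self]
            rcases ht with rfl | rfl
            · exact ⟨le_rfl, hlh⟩
            · exact ⟨hlh, le_rfl⟩
          · rw [Function.update_of_ne hee]; exact hy1 e'
        · intro e' he'
          by_cases hee : e' = e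
          · subst hee; rw [Function.update_self]; exact ht
          · rw [Function.update_of_ne hee]
            exact hy2 e' ((Finset.mem_insert.1 he').resolve_left hee)
        · rw [hac]; linarith
      rcases le_total 0 c with hc | hc
      · exact fin h (Or.inr rfl) (mul_le_mul_of_nonneg_left (hy1 e).2 hc)
      · exact fin l (Or.inl rfl) (mul_le_mul_of_nonpos_left (hy1 e).1 hc)
  obtain ⟨y, _, h2, h3⟩ := main Finset.univ
  exact ⟨y, fun e => h2 e (Finset.mem_univ _), h3⟩

/-- The multi-affine extension. -/
noncomputable def auxF {β : Type} [Fintype β] [DecidableEq β] (A : (β → Bool) → ℝ)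
    (x : β → ℝ) : ℝ := ∑ o : β → Bool, (∏ e, auxW (x e) (o e)) * A o

lemma auxF_affine {β : Type} [Fintype β] [DecidableEq β] (A : (β → Bool) → ℝ)
    (x : β → ℝ) (e : β) : ∃ a c, ∀ t, auxF A (Function.update x e t) = a + c * t := by
  refine ⟨∑ o : β → Bool, (if o e then 0 else 1) *
      (∏ e' ∈ Finset.univ.erase e, auxW (x e') (o e')) * A o,
    ∑ o : β → Bool, (if o e then 1 else -1) *
      (∏ e' ∈ Finset.univ.erase e, auxW (x e') (o e')) * A o, fun t => ?_⟩
  unfold auxF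
  rw [Finset.sum_mul, ← Finset.sum_add_distrib]
  refine Finset.sum_congr rfl fun o _ => ?_
  rw [← Finset.mul_prod_erase Finset.univ _ (Finset.mem_univ e), Function.update_self]
  have : ∏ e' ∈ Finset.univ.erase e, auxW (Function.update x e t e') (o e') =
      ∏ e' ∈ Finset.univ.erase e, auxW (x e') (o e') :=
    Finset.prod_congr rfl fun e' he' => by
      rw [Function.update_of_ne (Finset.ne_of_mem_erase he')]
  rw [this]
  unfold auxW
  cases o e <;> simp <;> ring

/-- Tournament from upper triangular coordinates. -/
noncomputable def auxT {n : ℕ} (x : MatchPair n → ℝ) (hx : ∀ e, x e ∈ Set.Icc (0:ℝ) 1) :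
    ProbTournament n where
  p i j := if h : i < j then x ⟨(i, j), h⟩ else if h' : j < i then 1 - x ⟨(j, i), h'⟩ else 0
  mem_Icc i j := by
    split_ifs with h h'
    · exact hx _
    · have := hx ⟨(j, i), h'⟩
      exact ⟨by linarith [this.2], by linarith [this.1]⟩
    · simp
  compl i j hij := by
    rcases lt_or_gt_of_ne hij with h | h
    · simp [h, not_lt.2 h.le]
    · simp [h, not_lt.2 h.le]

lemma auxX_auxT {n : ℕ} (x : MatchPair n → ℝ) (hx : ∀ e, x e ∈ Set.Icc (0:ℝ) 1) :
    auxX (auxT x hx) = x := by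
  funext e
  unfold auxX auxT
  exact dif_pos e.2

lemma aux_rPS_F (r : ∀ n : ℕ, Outcome n → Fin n → ℝ) {n : ℕ}
    (T : ProbTournament n) (S : Finset (Fin n)) :
    rPS r T S = auxF (fun o => ∑ i ∈ S, r n o i) (auxX T) := by
  rw [aux_rPS]
  simp only [aux_prob]
  rfl

lemma aux_weak (r : ∀ n : ℕ, Outcome n → Fin n → ℝ) (ε : ℝ) (hε : ε ∈ Set.Icc (0 : ℝ) (1/2))
    {n : ℕ} (u v : Fin n) (huv : u ≠ v) (T T' : ProbTournament n)
    (hT : WeaklyBounded ε n T) (h : Adjacent {u, v} T T') :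
    ∃ U U' : ProbTournament n, StrictlyBounded ε n U ∧ Adjacent {u, v} U U' ∧
      rPS r T' {u, v} - rPS r T {u, v} ≤ rPS r U' {u, v} - rPS r U {u, v} := by
  obtain ⟨e0, he0, hne⟩ := aux_pair u v huv
  let A : Outcome n → ℝ := fun o => ∑ i ∈ ({u, v} : Finset (Fin n)), r n o i
  let q := auxX T' e0
  have hX' : auxX T' = Function.update (auxX T) e0 q := by
    funext e
    by_cases he : e = e0
    · subst he; rw [Function.update_self]
    · rw [Function.update_of_ne he]; exact (aux_adj_X h e (hne e he)).symm
  let D : (MatchPair n → ℝ) → ℝ := fun x => auxF A (Function.update x e0 q) - auxF A x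
  have hD : ∀ x e, ∃ a c, ∀ t, D (Function.update x e t) = a + c * t := by
    intro x e
    obtain ⟨a, c, hac⟩ := auxF_affine A x e
    by_cases he : e = e0
    · subst he
      refine ⟨auxF A (Function.update x e q) - a, -c, fun t => ?_⟩
      simp only [D, Function.update_idem, hac t]
      ring
    · obtain ⟨a', c', hac'⟩ := auxF_affine A (Function.update x e0 q) e
      refine ⟨a' - a, c' - c, fun t => ?_⟩
      simp only [D]
      rw [Function.update_comm he, hac, hac']
      ring
  obtain ⟨y, hy, hle⟩ := aux_corner D hD (1/2 - ε) (1/2 + ε) (auxX T)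
    (fun e => hT _ _ (ne_of_lt e.2))
  have hy01 : ∀ e, y e ∈ Set.Icc (0:ℝ) 1 := by
    intro e
    obtain ⟨h0, h1⟩ := hε
    rcases hy e with h | h <;> rw [h] <;> constructor <;> linarith
  have hy01' : ∀ e, Function.update y e0 q e ∈ Set.Icc (0:ℝ) 1 := by
    intro e
    by_cases he : e = e0
    · subst he; rw [Function.update_self]; exact T'.mem_Icc _ _
    · rw [Function.update_of_ne he]; exact hy01 e
  refine ⟨auxT y hy01, auxT _ hy01', ?_, ?_, ?_⟩
  · intro i j hij
    unfold auxT
    rcases lt_or_gt_of_ne hij with h | h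
    · simp only [h, dite_true]
      exact hy _
    · simp only [h, not_lt.2 h.le, dite_true, dite_false]
      rcases hy ⟨(j, i), h⟩ with h | h
      · right; rw [h]; ring
      · left; rw [h]; ring
  · intro i j hij
    unfold auxT
    have hu : ∀ a b : Fin n, ∀ hab : a < b, ¬(a ∈ ({u, v} : Finset (Fin n)) ∧ b ∈ ({u, v} : Finset (Fin n))) →
        Function.update y e0 q ⟨(a, b), hab⟩ = y ⟨(a, b), hab⟩ := by
      intro a b hab hn
      rw [Function.update_of_ne]
      rintro rfl
      rcases he0 with h' | h' <;> simp only [Prod.mk.injEq] at h' <;> obtain ⟨rfl, rfl⟩ := h' <;>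
        simp at hn
    simp only
    split_ifs with h1 h2
    · exact (hu i j h1 hij).symm
    · rw [hu j i h2 fun h => hij ⟨h.2, h.1⟩]
    · rfl
  · simp only [aux_rPS_F, auxX_auxT, hX']
    exact hle

/-! ## Statement -/

theorem stmt2 (E : ElimRule) (ε : ℝ) (hε : ε ∈ Set.Icc (0 : ℝ) (1/2))
    (b g c : ℝ) (hb0 : 0 ≤ b) (hg0 : 0 ≤ g) (hc0 : 0 ≤ c) (hbg : 0 < b + g)
    (hB : ∀ n : ℕ, 1 < n → ∀ u v : Fin n, u ≠ v →
      (∑ M : Finset (MatchPair n), E.d n M * (if matchMem M u v then 1 else 0)) ≤ b)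
    (hG : ∀ n : ℕ, 1 < n → ∀ u v : Fin n, u ≠ v →
      ∀ T : ProbTournament n, StrictlyBounded ε n T →
      g ≤ ∑ M : Finset (MatchPair n), E.d n M *
        (if matchMem M u v then 0 else
          ∑ o : Outcome n, T.prob o *
            (if IsBaseCase (recWin E) (restrictProb T (survivors o M))
                (mapTeams (survivors o M) {u, v}) then 1 else 0)))
    (hC : ∀ n : ℕ, 1 < n → ∀ u v : Fin n, u ≠ v →
      ∀ T T' : ProbTournament n, StrictlyBounded ε n T → Adjacent {u, v} T T' →
      (∑ M : Finset (MatchPair n), E.d n M *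
          (if matchMem M u v then
            valAfter (recWin E) T' M {u, v} - valAfter (recWin E) T M {u, v} else 0))
        ≤ c * ∑ M : Finset (MatchPair n), E.d n M * (if matchMem M u v then 1 else 0)) :
    alph (recWin E) 2 (WeaklyBounded ε) ≤ b * c / (b + g) := by
  unfold alph
  refine Real.sSup_le ?_ (by positivity)
  rintro x ⟨n, T, T', S, hT, hS, hadj, rfl⟩
  by_cases hS1 : S.card ≤ 1
  · rw [aux_small _ S hS1 T T' hadj, sub_self]; positivity
  obtain ⟨u, v, huv, rfl⟩ := Finset.card_eq_two.1 (show S.card = 2 by omega)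
  obtain ⟨U, U', hU, hUU, hle⟩ := aux_weak (recWin E) ε hε u v huv T T' hT hadj
  exact hle.trans (aux_strict E ε b g c hb0 hg0 hc0 hbg hB hG hC n U U' {u, v} hU hS hUU)
end

section
/- Randomized Death Match is 2-SNM-1/3, and this is tight: α₂^{RDM}(𝒯^{1/2}) = 1/3. In particular, for every independent probabilistic tournament T, every pair of teams S = {u,v}, and every T' that is S-adjacent to T, RDM_S(T') − RDM_S(T) ≤ 1/3, and the supremum of such gains over all tournaments and pairs equals 1/3. -/
open scoped Classical
open Finset

/-! ## Statement -/

namespace RDMProof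

/-- One summand of the RDM recursion. -/
noncomputable def term (fuel : ℕ) {n : ℕ} (o : Outcome n) (s : Finset (Fin n)) (i : Fin n) : ℝ :=
  if h : i ∈ s then
        RDMAux fuel s.card (restrictOutcome o s)
          ((s.orderIsoOfFin rfl).symm ⟨i, h⟩)
      else 0

theorem RDMAux_succ (fuel n : ℕ) (hn : 1 < n) (o : Outcome n) (i : Fin n) :
    RDMAux (fuel + 1) n o i =
      ((n.choose 2 : ℝ))⁻¹ * ∑ e : MatchPair n, term fuel o (survivors o {e}) i := by
  rw [RDMAux, if_neg (by omega)]
  rfl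

theorem RDMAux_one (fuel : ℕ) (o : Outcome 1) (i : Fin 1) : RDMAux fuel 1 o i = 1 := by
  cases fuel <;> simp [RDMAux]

theorem card_matchPair (n : ℕ) : Fintype.card (MatchPair n) = n.choose 2 := by
  have h := Sym2.card_subtype_not_diag (α := Fin n)
  rw [Fintype.card_fin] at h
  rw [← h]
  symm
  apply Fintype.card_congr
  refine Equiv.symm (Equiv.ofBijective
    (fun e : MatchPair n => ⟨s(e.val.1, e.val.2), by simpa using e.2.ne⟩) ⟨?_, ?_⟩)
  · rintro ⟨⟨a, b⟩, h⟩ ⟨⟨c, d⟩, h'⟩ he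
    simp only [Subtype.mk.injEq, Sym2.eq_iff] at he
    simp only at h h'
    rcases he with ⟨rfl, rfl⟩ | ⟨rfl, rfl⟩
    · rfl
    · exact absurd h (lt_asymm h')
  · rintro ⟨z, hz⟩
    induction z using Sym2.inductionOn with
    | _ a b =>
      have hab : a ≠ b := by simpa using hz
      rcases lt_or_gt_of_ne hab with h | h
      · exact ⟨⟨(a, b), h⟩, rfl⟩
      · exact ⟨⟨(b, a), h⟩, by simp [Sym2.eq_swap]⟩

theorem beats_swap {n : ℕ} (o : Outcome n) {i j : Fin n} (h : i ≠ j) :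
    Outcome.beats o j i = !Outcome.beats o i j := by
  unfold Outcome.beats
  rcases lt_or_gt_of_ne h with h | h
  · simp [h, not_lt_of_gt h]
  · simp [h, not_lt_of_gt h]

theorem beats_self {n : ℕ} (o : Outcome n) (i : Fin n) : Outcome.beats o i i = false := by
  simp [Outcome.beats]

theorem beats_restrict {n : ℕ} (o : Outcome n) (s : Finset (Fin n)) (a b : Fin s.card) :
    Outcome.beats (restrictOutcome o s) a b =
      Outcome.beats o (s.orderIsoOfFin rfl a) (s.orderIsoOfFin rfl b) := by
  rcases lt_trichotomy a b with h | h | h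
  · conv_lhs => unfold Outcome.beats
    simp [h, restrictOutcome]
  · subst h; simp [beats_self]
  · have hne : ((s.orderIsoOfFin rfl b : s) : Fin n) ≠ (s.orderIsoOfFin rfl a : s) := by
      intro h'
      exact h.ne ((s.orderIsoOfFin rfl).injective (Subtype.coe_injective h'))
    rw [beats_swap o hne]
    conv_lhs => unfold Outcome.beats
    simp [h, not_lt_of_gt h, restrictOutcome]

theorem ext_beats {n : ℕ} {o o' : Outcome n}
    (h : ∀ i j, Outcome.beats o i j = Outcome.beats o' i j) : o = o' := by
  funext e
  have := h e.val.1 e.val.2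
  simpa [Outcome.beats, e.2] using this

theorem sum_term (fuel : ℕ) {n : ℕ} (o : Outcome n) (s : Finset (Fin n)) :
    ∑ i, term fuel o s i = ∑ a, RDMAux fuel s.card (restrictOutcome o s) a := by
  have h1 : ∑ i, term fuel o s i = ∑ i ∈ s, term fuel o s i := by
    symm
    apply Finset.sum_subset (Finset.subset_univ _)
    intro x _ hx
    simp [term, hx]
  rw [h1, ← Finset.sum_coe_sort]
  symm
  apply Fintype.sum_equiv (s.orderIsoOfFin rfl).toEquiv
  intro a
  change _ = term fuel o s (s.orderIsoOfFin rfl a : s)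
  rw [term, dif_pos (s.orderIsoOfFin rfl a).2]
  congr 1
  exact (OrderIso.symm_apply_apply (s.orderIsoOfFin rfl) a).symm

theorem RDMAux_nonneg (fuel : ℕ) : ∀ (n : ℕ) (o : Outcome n) (i : Fin n),
    0 ≤ RDMAux fuel n o i := by
  induction fuel with
  | zero => intro n o i; simp only [RDMAux]; split_ifs <;> norm_num
  | succ f ih =>
    intro n o i
    by_cases hn : 1 < n
    · rw [RDMAux_succ _ _ hn]
      apply mul_nonneg (by positivity)
      apply Finset.sum_nonneg
      intro e _
      unfold term
      split_ifs
      · exact ih _ _ _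
      · exact le_rfl
    · rw [RDMAux, if_pos (by omega)]; split_ifs <;> norm_num

theorem term_nonneg (fuel : ℕ) {n : ℕ} (o : Outcome n) (s : Finset (Fin n)) (i : Fin n) :
    0 ≤ term fuel o s i := by
  unfold term
  split_ifs
  · exact RDMAux_nonneg _ _ _ _
  · exact le_rfl

theorem choose_pos' {n : ℕ} (hn : 1 < n) : (0 : ℝ) < n.choose 2 := by
  exact_mod_cast Nat.choose_pos hn

theorem RDMAux_sum_le (fuel : ℕ) : ∀ (n : ℕ) (o : Outcome n),
    ∑ i, RDMAux fuel n o i ≤ 1 := by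
  induction fuel with
  | zero =>
    intro n o; simp only [RDMAux]; split_ifs with h
    · subst h; simp
    · simp
  | succ f ih =>
    intro n o
    by_cases hn : 1 < n
    · simp_rw [RDMAux_succ _ _ hn]
      rw [← Finset.mul_sum, Finset.sum_comm, inv_mul_le_iff₀ (choose_pos' hn)]
      calc _ ≤ ∑ e : MatchPair n, (1 : ℝ) := by
            apply Finset.sum_le_sum
            intro e _
            rw [sum_term]
            exact ih _ _
        _ = _ := by simp [← card_matchPair]
    · have : n = 0 ∨ n = 1 := by omega
      rcases this with rfl | rfl
      · simp
      · simp [RDMAux_one]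

theorem pair_le (fuel n : ℕ) (o : Outcome n) {u v : Fin n} (huv : u ≠ v) :
    RDMAux fuel n o u + RDMAux fuel n o v ≤ 1 := by
  refine le_trans ?_ (RDMAux_sum_le fuel n o)
  rw [← Finset.sum_pair huv (f := fun i => RDMAux fuel n o i)]
  exact Finset.sum_le_sum_of_subset_of_nonneg (Finset.subset_univ _)
    (fun i _ _ => RDMAux_nonneg _ _ _ _)

theorem term_pair_le (fuel : ℕ) {n : ℕ} (o : Outcome n) (s : Finset (Fin n))
    {u v : Fin n} (huv : u ≠ v) :
    term fuel o s u + term fuel o s v ≤ 1 := by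
  refine le_trans ?_ (RDMAux_sum_le fuel s.card (restrictOutcome o s))
  rw [← sum_term, ← Finset.sum_pair huv (f := fun i => term fuel o s i)]
  exact Finset.sum_le_sum_of_subset_of_nonneg (Finset.subset_univ _)
    (fun i _ _ => term_nonneg _ _ _ _)

/-- The match between two distinct teams. -/
def mkM {n : ℕ} (i j : Fin n) (h : i ≠ j) : MatchPair n :=
  if hlt : i < j then ⟨(i, j), hlt⟩ else ⟨(j, i), lt_of_le_of_ne (not_lt.mp hlt) h.symm⟩

theorem mkM_eq {n : ℕ} (i j : Fin n) (h : i ≠ j) :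
    ((mkM i j h).val.1 = i ∧ (mkM i j h).val.2 = j) ∨
    ((mkM i j h).val.1 = j ∧ (mkM i j h).val.2 = i) := by
  unfold mkM
  split_ifs <;> simp

theorem survivors_of_beats {n : ℕ} (o : Outcome n) (e : MatchPair n) (i j : Fin n)
    (he : (e.val.1 = i ∧ e.val.2 = j) ∨ (e.val.1 = j ∧ e.val.2 = i))
    (hb : Outcome.beats o i j = true) : survivors o {e} = Finset.univ.erase j := by
  have hij : i ≠ j := by
    rintro rfl
    simp [beats_self] at hb
  have hb' : Outcome.beats o j i = false := by rw [beats_swap o hij, hb]; rfl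
  ext x
  simp only [survivors, losesIn, Finset.mem_singleton, exists_eq_left, Finset.mem_filter,
    Finset.mem_univ, true_and, Finset.mem_erase, and_true]
  rcases he with ⟨h1, h2⟩ | ⟨h1, h2⟩ <;> rw [h1, h2] <;> grind

theorem exists_winner {n : ℕ} (o : Outcome n) (e : MatchPair n) :
    ∃ i j, ((e.val.1 = i ∧ e.val.2 = j) ∨ (e.val.1 = j ∧ e.val.2 = i)) ∧
      Outcome.beats o i j = true := by
  by_cases h : Outcome.beats o e.val.1 e.val.2 = true
  · exact ⟨_, _, Or.inl ⟨rfl, rfl⟩, h⟩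
  · refine ⟨e.val.2, e.val.1, Or.inr ⟨rfl, rfl⟩, ?_⟩
    rw [beats_swap o e.2.ne]; simpa using h

theorem survivors_card_lt {n : ℕ} (o : Outcome n) (e : MatchPair n) :
    (survivors o {e}).card < n := by
  obtain ⟨i, j, he, hb⟩ := exists_winner o e
  rw [survivors_of_beats o e i j he hb, Finset.card_erase_of_mem (Finset.mem_univ _)]
  have := j.pos
  simp only [Finset.card_univ, Fintype.card_fin]
  omega

theorem condorcet (fuel : ℕ) : ∀ (n : ℕ) (o : Outcome n) (i : Fin n), n ≤ fuel →
    (∀ j, j ≠ i → Outcome.beats o i j = true) → RDMAux fuel n o i = 1 := by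
  induction fuel with
  | zero => intro n o i hn; have := i.pos; omega
  | succ f ih =>
    intro n o i hn hc
    by_cases h1 : 1 < n
    · rw [RDMAux_succ _ _ h1]
      have : ∀ e ∈ (Finset.univ : Finset (MatchPair n)),
          term f o (survivors o {e}) i = 1 := by
        intro e _
        have hlt := survivors_card_lt o e
        have hm : i ∈ survivors o {e} := by
          obtain ⟨a, b, he, hb⟩ := exists_winner o e
          rw [survivors_of_beats o e a b he hb]
          simp only [Finset.mem_erase, Finset.mem_univ, and_true]
          rintro rfl
          have hab : a ≠ i := by
            rintro rfl
            simp [beats_self] at hb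
          have := hc a hab
          rw [beats_swap o hab, hb] at this
          simp at this
        rw [term, dif_pos hm]
        apply ih _ _ _ (by omega)
        intro j hj
        rw [beats_restrict]
        simp only [OrderIso.apply_symm_apply]
        apply hc
        intro h
        apply hj
        apply (Finset.orderIsoOfFin _ rfl).injective
        apply Subtype.coe_injective
        simpa using h
      rw [Finset.sum_congr rfl this]
      simp only [Finset.sum_const, Finset.card_univ, card_matchPair, nsmul_eq_mul, mul_one]
      exact inv_mul_cancel₀ (choose_pos' h1).ne'
    · have : n = 1 := by have := i.pos; omega
      subst this
      exact RDMAux_one _ _ _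

/-- The two outcomes agree on all matches except possibly `u` against `v`. -/
def Agree {n : ℕ} (u v : Fin n) (o o' : Outcome n) : Prop :=
  ∀ i j : Fin n, ¬ (i = u ∧ j = v) → ¬ (i = v ∧ j = u) →
    Outcome.beats o i j = Outcome.beats o' i j

theorem survivors_agree {n : ℕ} {u v : Fin n} {o o' : Outcome n} (h : Agree u v o o')
    (e : MatchPair n) (he1 : ¬ (e.val.1 = u ∧ e.val.2 = v))
    (he2 : ¬ (e.val.1 = v ∧ e.val.2 = u)) : survivors o {e} = survivors o' {e} := by
  obtain ⟨i, j, he, hb⟩ := exists_winner o e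
  rw [survivors_of_beats o e i j he hb]
  rw [survivors_of_beats o' e i j he]
  rw [← h i j (by grind) (by grind)]
  exact hb

theorem restrict_agree_eq {n : ℕ} {u v : Fin n} {o o' : Outcome n} (h : Agree u v o o')
    (s : Finset (Fin n)) (hs : u ∉ s ∨ v ∉ s) : restrictOutcome o s = restrictOutcome o' s := by
  apply ext_beats
  intro a b
  rw [beats_restrict, beats_restrict]
  have ha := (s.orderIsoOfFin rfl a).2
  have hb := (s.orderIsoOfFin rfl b).2
  apply h <;> rintro ⟨h1, h2⟩ <;> rw [h1] at ha <;> rw [h2] at hb <;> tauto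

theorem restrict_agree {n : ℕ} {u v : Fin n} {o o' : Outcome n} (h : Agree u v o o')
    (s : Finset (Fin n)) (hu : u ∈ s) (hv : v ∈ s) :
    Agree ((s.orderIsoOfFin rfl).symm ⟨u, hu⟩) ((s.orderIsoOfFin rfl).symm ⟨v, hv⟩)
      (restrictOutcome o s) (restrictOutcome o' s) := by
  intro a b h1 h2
  rw [beats_restrict, beats_restrict]
  have key : ∀ (x : Fin s.card) (w : Fin n) (hw : w ∈ s),
      ((s.orderIsoOfFin rfl x : s) : Fin n) = w → x = (s.orderIsoOfFin rfl).symm ⟨w, hw⟩ := by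
    intro x w hw hx
    rw [OrderIso.eq_symm_apply]
    exact Subtype.ext hx
  apply h
  · rintro ⟨e1, e2⟩; exact h1 ⟨key _ _ _ e1, key _ _ _ e2⟩
  · rintro ⟨e1, e2⟩; exact h2 ⟨key _ _ _ e1, key _ _ _ e2⟩

theorem diff_le_of_condorcet (fuel : ℕ) {n : ℕ} (hn : n ≤ fuel) (o o' : Outcome n)
    {u v : Fin n} (huv : u ≠ v) (hc : ∀ j, j ≠ v → Outcome.beats o' v j = true) :
    RDMAux fuel n o u + RDMAux fuel n o v - RDMAux fuel n o' u - RDMAux fuel n o' v ≤ 0 := by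
  have h1 := pair_le fuel n o huv
  have h2 := condorcet fuel n o' v hn hc
  have h3 := RDMAux_nonneg fuel n o' u
  linarith

/-- gain term -/
noncomputable def gain (fuel : ℕ) {n : ℕ} (o o' : Outcome n) (u v : Fin n) (e : MatchPair n) : ℝ :=
  term fuel o (survivors o {e}) u + term fuel o (survivors o {e}) v
    - term fuel o' (survivors o' {e}) u - term fuel o' (survivors o' {e}) v

theorem gain_zero (fuel : ℕ) {n : ℕ} {o o' : Outcome n} {u v : Fin n} (h : Agree u v o o')
    (e : MatchPair n) (he1 : ¬ (e.val.1 = u ∧ e.val.2 = v))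
    (he2 : ¬ (e.val.1 = v ∧ e.val.2 = u))
    (hs : u ∉ survivors o' {e} ∨ v ∉ survivors o' {e}) : gain fuel o o' u v e = 0 := by
  unfold gain
  rw [survivors_agree h e he1 he2]
  unfold term
  rw [restrict_agree_eq h _ hs]
  ring

theorem sum_bound {ι : Type*} [Fintype ι] [DecidableEq ι] (g : ι → ℝ) (a b c : ι) (hab : a ≠ b)
    (hac : a ≠ c) (hbc : b ≠ c) (ha : g a ≤ 1) (hb : g b ≤ 0) (hc : g c ≤ 0)
    (h : ∀ x, x ≠ a → g x ≤ 1/3) : ∑ x, g x ≤ Fintype.card ι * (1/3) := by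
  have hle : ∀ x ∈ (Finset.univ : Finset ι), g x ≤
      1/3 + (if x = a then 2/3 else 0) - (if x = b then 1/3 else 0)
        - (if x = c then 1/3 else 0) := by
    intro x _
    by_cases h1 : x = a
    · subst h1; simp only [hab, hac, if_true, if_false]; linarith
    · by_cases h2 : x = b
      · subst h2; simp only [h1, hbc, if_true, if_false]; linarith
      · by_cases h3 : x = c
        · subst h3; simp only [h1, h2, if_true, if_false]; linarith
        · simp only [h1, h2, h3, if_false]; linarith [h x h1]
  refine (Finset.sum_le_sum hle).trans (le_of_eq ?_)
  simp [Finset.sum_add_distrib, Finset.sum_sub_distrib]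
  ring

theorem main_det (fuel : ℕ) : ∀ (n : ℕ) (o o' : Outcome n) (u v : Fin n), n ≤ fuel → u ≠ v →
    Agree u v o o' → Outcome.beats o' v u = true →
    RDMAux fuel n o u + RDMAux fuel n o v - RDMAux fuel n o' u - RDMAux fuel n o' v ≤ 1/3 := by
  induction fuel with
  | zero => intro n o o' u v hn; have := u.pos; omega
  | succ f ih =>
    intro n o o' u v hn huv hag hvu
    by_cases hc : ∀ j, j ≠ v → Outcome.beats o' v j = true
    · exact (diff_le_of_condorcet (f+1) hn o o' huv hc).trans (by norm_num)
    push Not at hc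
    obtain ⟨w, hwv, hw⟩ := hc
    have hwu : w ≠ u := by rintro rfl; exact hw hvu
    have hbw : Outcome.beats o' w v = true := by
      rw [beats_swap o' hwv.symm]; simpa using hw
    have h1 : 1 < n := by
      by_contra h
      apply huv
      apply Fin.ext
      have := u.2
      have := v.2
      omega
    have hgain1 : ∀ e, gain f o o' u v e ≤ 1 := by
      intro e
      have := term_pair_le f o (survivors o {e}) huv
      have := term_nonneg f o' (survivors o' {e}) u
      have := term_nonneg f o' (survivors o' {e}) v
      unfold gain
      linarith
    -- matches other than `u` vs `v`
    have hgain : ∀ e : MatchPair n, e ≠ mkM u v huv → gain f o o' u v e ≤ 1/3 := by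
      intro e hne
      have he1 : ¬ (e.val.1 = u ∧ e.val.2 = v) := by
        rintro ⟨rfl, rfl⟩
        apply hne
        simp [mkM, e.2]
      have he2 : ¬ (e.val.1 = v ∧ e.val.2 = u) := by
        rintro ⟨rfl, rfl⟩
        apply hne
        simp [mkM, not_lt_of_gt e.2]
      by_cases hs : u ∈ survivors o' {e} ∧ v ∈ survivors o' {e}
      · have hlt := survivors_card_lt o' e
        unfold gain
        rw [survivors_agree hag e he1 he2]
        simp only [term, dif_pos hs.1, dif_pos hs.2]
        apply ih
        · omega
        · intro h; apply huv
          simpa using h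
        · exact restrict_agree hag _ _ _
        · rw [beats_restrict]; simpa using hvu
      · rw [gain_zero f hag e he1 he2 (by tauto)]; norm_num
    -- a match in which `v` loses to someone
    have hlose : ∀ x (hxv : x ≠ v), x ≠ u → Outcome.beats o' x v = true →
        gain f o o' u v (mkM x v hxv) ≤ 0 := by
      intro x hxv hxu hb
      have hm := mkM_eq x v hxv
      apply le_of_eq
      apply gain_zero f hag
      · grind
      · grind
      · right
        rw [survivors_of_beats o' _ x v hm hb]
        simp
    have hmk : ∀ a b c d : Fin n, ∀ (hab : a ≠ b) (hcd : c ≠ d), (a ≠ c ∨ b ≠ d) → (a ≠ d ∨ b ≠ c) →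
        mkM a b hab ≠ mkM c d hcd := by
      intro a b c d hab hcd h1 h2 h
      have e1 := mkM_eq a b hab
      have e2 := mkM_eq c d hcd
      rw [h] at e1
      grind
    have hsum : ∑ e, gain f o o' u v e ≤ (n.choose 2 : ℝ) * (1/3) := by
      rw [← card_matchPair]
      by_cases h2 : ∃ x, x ≠ w ∧ x ≠ v ∧ Outcome.beats o' x v = true
      · obtain ⟨x, hxw, hxv, hbx⟩ := h2
        have hxu : x ≠ u := by
          rintro rfl
          rw [beats_swap o' hxv.symm, hvu] at hbx
          simp at hbx
        refine sum_bound _ (mkM u v huv) (mkM w v hwv) (mkM x v hxv) ?_ ?_ ?_ (hgain1 _)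
          (hlose w hwv hwu hbw) (hlose x hxv hxu hbx) hgain
        · apply hmk <;> grind
        · apply hmk <;> grind
        · apply hmk <;> grind
      · push Not at h2
        refine sum_bound _ (mkM u v huv) (mkM w v hwv) (mkM w u hwu) ?_ ?_ ?_ (hgain1 _)
          (hlose w hwv hwu hbw) ?_ hgain
        · apply hmk <;> grind
        · apply hmk <;> grind
        · apply hmk <;> grind
        · have hm := mkM_eq w u hwu
          have he1 : ¬ ((mkM w u hwu).val.1 = u ∧ (mkM w u hwu).val.2 = v) := by grind
          have he2 : ¬ ((mkM w u hwu).val.1 = v ∧ (mkM w u hwu).val.2 = u) := by grind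
          by_cases hb : Outcome.beats o' w u = true
          · apply le_of_eq
            apply gain_zero f hag _ he1 he2
            left
            rw [survivors_of_beats o' _ w u hm hb]
            simp
          · have hb' : Outcome.beats o' u w = true := by
              rw [beats_swap o' hwu]; simpa using hb
            have hlt := survivors_card_lt o' (mkM w u hwu)
            have hsv := survivors_of_beats o' (mkM w u hwu) u w (by tauto) hb'
            have hu : u ∈ survivors o' {mkM w u hwu} := by rw [hsv]; simp [hwu.symm]
            have hv : v ∈ survivors o' {mkM w u hwu} := by rw [hsv]; simp [hwv.symm]
            have hw' : w ∉ survivors o' {mkM w u hwu} := by rw [hsv]; simp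
            unfold gain
            rw [survivors_agree hag _ he1 he2]
            simp only [term, dif_pos hu, dif_pos hv]
            apply diff_le_of_condorcet f (by omega)
            · intro h; apply huv; simpa using h
            · intro j hj
              rw [beats_restrict]
              simp only [OrderIso.apply_symm_apply]
              have hjm := (Finset.orderIsoOfFin _ rfl j : {x // x ∈ survivors o' {mkM w u hwu}}).2
              have hjv : ((Finset.orderIsoOfFin _ rfl j :
                  {x // x ∈ survivors o' {mkM w u hwu}}) : Fin n) ≠ v := by
                intro h
                apply hj
                rw [OrderIso.eq_symm_apply]
                exact Subtype.ext h
              have hjw : ((Finset.orderIsoOfFin _ rfl j :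
                  {x // x ∈ survivors o' {mkM w u hwu}}) : Fin n) ≠ w := by
                intro h
                rw [h] at hjm
                exact hw' hjm
              rw [beats_swap o' hjv]
              simpa using h2 _ hjw hjv
    simp_rw [RDMAux_succ f n h1]
    rw [← mul_add, ← mul_sub, ← mul_sub, inv_mul_le_iff₀ (choose_pos' h1),
      ← Finset.sum_add_distrib, ← Finset.sum_sub_distrib, ← Finset.sum_sub_distrib]
    exact hsum

theorem main_det' (n : ℕ) (o o' : Outcome n) (u v : Fin n) (huv : u ≠ v)
    (hag : Agree u v o o') :
    (RDM n o u + RDM n o v) - (RDM n o' u + RDM n o' v) ≤ 1/3 := by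
  unfold RDM
  by_cases h : Outcome.beats o' v u = true
  · linarith [main_det n n o o' u v le_rfl huv hag h]
  · have hwin : Outcome.beats o' u v = true := by
      rw [beats_swap o' huv.symm]; simpa using h
    have hagree : Agree v u o o' := fun i j h1 h2 => hag i j h2 h1
    linarith [main_det n n o o' v u le_rfl huv.symm hagree hwin]

/-! ### Averaging over outcomes -/

theorem factor_nonneg {n : ℕ} (T : ProbTournament n) (e : MatchPair n) (b : Bool) :
    0 ≤ (if b then T.p e.val.1 e.val.2 else T.p e.val.2 e.val.1) := by
  split_ifs
  · exact (T.mem_Icc _ _).1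
  · exact (T.mem_Icc _ _).1

theorem prob_sum {n : ℕ} (T : ProbTournament n) : ∑ o : Outcome n, T.prob o = 1 := by
  unfold ProbTournament.prob
  have := Finset.prod_univ_sum (fun _ : MatchPair n => (Finset.univ : Finset Bool))
    (fun e b => if b then T.p e.val.1 e.val.2 else T.p e.val.2 e.val.1)
  rw [Fintype.piFinset_univ] at this
  rw [← this]
  apply Finset.prod_eq_one
  intro e _
  simp [T.compl _ _ e.2.ne]

/-- flip the result of the match `e` -/
def flip {n : ℕ} (e : MatchPair n) (o : Outcome n) : Outcome n := Function.update o e (!o e)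

theorem flip_flip {n : ℕ} (e : MatchPair n) (o : Outcome n) : flip e (flip e o) = o := by
  simp [flip]

theorem sum_flip {n : ℕ} (e : MatchPair n) (F : Outcome n → ℝ) :
    ∑ o, F (flip e o) = ∑ o, F o :=
  Fintype.sum_equiv ⟨flip e, flip e, flip_flip e, flip_flip e⟩ _ _ (fun _ => rfl)

theorem avg {n : ℕ} (T T' : ProbTournament n) (e : MatchPair n) (R : Outcome n → ℝ)
    (hT : ∀ e', e' ≠ e → T.p e'.val.1 e'.val.2 = T'.p e'.val.1 e'.val.2 ∧
      T.p e'.val.2 e'.val.1 = T'.p e'.val.2 e'.val.1)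
    (hR : ∀ o, R o - R (flip e o) ≤ 1/3) :
    ∑ o, T'.prob o * R o - ∑ o, T.prob o * R o ≤ 1/3 := by
  let Q : Outcome n → ℝ := fun o => ∏ e' ∈ Finset.univ.erase e,
    (if o e' then T.p e'.val.1 e'.val.2 else T.p e'.val.2 e'.val.1)
  let w : ProbTournament n → Outcome n → ℝ := fun T o =>
    (if o e then T.p e.val.1 e.val.2 else T.p e.val.2 e.val.1)
  have hQ0 : ∀ o, 0 ≤ Q o := fun o => Finset.prod_nonneg (fun e' _ => factor_nonneg T e' _)
  have hQf : ∀ o, Q (flip e o) = Q o := by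
    intro o
    apply Finset.prod_congr rfl
    intro e' he'
    have : e' ≠ e := Finset.ne_of_mem_erase he'
    simp [flip, Function.update_of_ne this]
  have hP : ∀ o, T.prob o = w T o * Q o := fun o =>
    (Finset.mul_prod_erase _ _ (Finset.mem_univ e)).symm
  have hP' : ∀ o, T'.prob o = w T' o * Q o := by
    intro o
    unfold ProbTournament.prob
    rw [← Finset.mul_prod_erase _ _ (Finset.mem_univ e)]
    congr 1
    apply Finset.prod_congr rfl
    intro e' he'
    have : e' ≠ e := Finset.ne_of_mem_erase he'
    rw [(hT e' this).1, (hT e' this).2]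
  have hwf : ∀ (T : ProbTournament n) o, w T (flip e o) = 1 - w T o := by
    intro T o
    have := T.compl _ _ e.2.ne
    simp only [w, flip, Function.update_self]
    cases o e <;> simp <;> linarith
  have hw : ∀ (T : ProbTournament n) o, 0 ≤ w T o ∧ w T o ≤ 1 := by
    intro T o
    simp only [w]
    split_ifs
    · exact T.mem_Icc _ _
    · exact T.mem_Icc _ _
  have hQs : ∑ o, Q o = 2 := by
    have h1 := prob_sum T
    have h2 := sum_flip e T.prob
    simp_rw [hP] at h1 h2
    rw [h1] at h2
    simp_rw [hQf, hwf] at h2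
    have : ∑ o, Q o = ∑ o, (1 - w T o) * Q o + ∑ o, w T o * Q o := by
      rw [← Finset.sum_add_distrib]
      apply Finset.sum_congr rfl
      intro o _
      ring
    rw [this, h1, h2]; norm_num
  have hD : ∑ o, T'.prob o * R o - ∑ o, T.prob o * R o =
      ∑ o, (w T' o - w T o) * Q o * R o := by
    rw [← Finset.sum_sub_distrib]
    apply Finset.sum_congr rfl
    intro o _
    rw [hP, hP']; ring
  have hD2 := sum_flip e (fun o => (w T' o - w T o) * Q o * R o)
  simp_rw [hQf, hwf] at hD2
  rw [hD]
  have hfin : ∑ o, (w T' o - w T o) * Q o * R o +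
      ∑ o, (1 - w T' o - (1 - w T o)) * Q o * R (flip e o) ≤ ∑ o, Q o * (1/3) := by
    rw [← Finset.sum_add_distrib]
    apply Finset.sum_le_sum
    intro o _
    have hr1 := hR o
    have hr2 := hR (flip e o)
    rw [flip_flip] at hr2
    have hd : (w T' o - w T o) * (R o - R (flip e o)) ≤ 1/3 := by
      have h1 := hw T o
      have h2 := hw T' o
      rcases le_total 0 (w T' o - w T o) with h | h <;> nlinarith
    have := mul_le_mul_of_nonneg_left hd (hQ0 o)
    linarith
  rw [← Finset.sum_mul, hQs, hD2] at hfin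
  linarith

theorem flip_agree {n : ℕ} (u v : Fin n) (huv : u ≠ v) (o : Outcome n) :
    Agree u v o (flip (mkM u v huv) o) := by
  intro i j h1 h2
  have hm := mkM_eq u v huv
  unfold Outcome.beats flip
  split_ifs with h h'
  · rw [Function.update_of_ne]
    rintro h3
    rw [← h3] at hm
    grind
  · rw [Function.update_of_ne]
    rintro h3
    rw [← h3] at hm
    grind
  · rfl

theorem part1 (n : ℕ) (T T' : ProbTournament n) (u v : Fin n) (huv : u ≠ v)
    (hA : Adjacent {u, v} T T') : rPS RDM T' {u, v} - rPS RDM T {u, v} ≤ 1/3 := by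
  have hr : ∀ T : ProbTournament n, rPS RDM T {u, v} =
      ∑ o, T.prob o * (RDM n o u + RDM n o v) := by
    intro T
    rw [rPS, Finset.sum_pair huv, rP, rP, ← Finset.sum_add_distrib]
    simp_rw [mul_add]
  rw [hr, hr]
  apply avg T T' (mkM u v huv)
  · intro e he
    have key : ¬ (e.val.1 ∈ ({u, v} : Finset (Fin n)) ∧ e.val.2 ∈ ({u, v} : Finset (Fin n))) := by
      intro h
      apply he
      have hlt := e.2
      simp only [Finset.mem_insert, Finset.mem_singleton] at h
      rcases h with ⟨h1 | h1, h2 | h2⟩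
      · rw [h1, h2] at hlt; exact absurd hlt (lt_irrefl _)
      · apply Subtype.ext; rw [h1, h2] at hlt
        simp only [mkM, dif_pos hlt]
        exact Prod.ext h1 h2
      · apply Subtype.ext; rw [h1, h2] at hlt
        simp only [mkM, dif_neg (not_lt_of_gt hlt)]
        exact Prod.ext h1 h2
      · rw [h1, h2] at hlt; exact absurd hlt (lt_irrefl _)
    exact ⟨hA _ _ key, hA _ _ (fun h => key h.symm)⟩
  · intro o
    exact main_det' n o _ u v huv (flip_agree u v huv o)

/-! ### Tightness -/

/-- deterministic tournament as a probabilistic one -/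
noncomputable def detT {n : ℕ} (o : Outcome n) : ProbTournament n where
  p i j := if Outcome.beats o i j then 1 else 0
  mem_Icc i j := by split_ifs <;> simp
  compl i j h := by
    rw [beats_swap o h]
    cases Outcome.beats o i j <;> simp

theorem detT_prob {n : ℕ} (o o' : Outcome n) : (detT o).prob o' = if o' = o then 1 else 0 := by
  unfold ProbTournament.prob
  have hf : ∀ e : MatchPair n, (if o' e then (detT o).p e.val.1 e.val.2
      else (detT o).p e.val.2 e.val.1) = if o' e = o e then 1 else 0 := by
    intro e
    simp only [detT]
    rw [beats_swap o e.2.ne]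
    have : Outcome.beats o e.val.1 e.val.2 = o e := by simp [Outcome.beats, e.2]
    rw [this]
    cases o' e <;> cases o e <;> simp
  simp_rw [hf]
  split_ifs with h
  · subst h; simp
  · obtain ⟨e, he⟩ := Function.ne_iff.mp h
    exact Finset.prod_eq_zero (Finset.mem_univ e) (by simp [he])

theorem detT_rP {n : ℕ} (o : Outcome n) (i : Fin n) : rP RDM (detT o) i = RDM n o i := by
  simp [rP, detT_prob]

/-- `0` beats `1` and `2`, and `2` beats `1`. -/
def oA : Outcome 3 := fun e => decide (e.val.1 = 0)

/-- `1` beats `0`, `0` beats `2`, `2` beats `1`. -/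
def oB : Outcome 3 := fun e => decide (e.val.1 = 0 ∧ e.val.2 = 2)

theorem oA_win : RDM 3 oA 0 = 1 := by
  apply condorcet _ _ _ _ le_rfl
  intro j hj
  have : (0 : Fin 3) < j := Fin.pos_of_ne_zero hj
  simp [Outcome.beats, this, oA]

theorem oB_le : RDM 3 oB 0 + RDM 3 oB 1 ≤ 2/3 := by
  have hs := RDMAux_sum_le 3 3 oB
  rw [Fin.sum_univ_three] at hs
  have h2 : 1/3 ≤ RDMAux 3 3 oB 2 := by
    rw [RDMAux_succ 2 3 (by norm_num)]
    have hge : term 2 oB (survivors oB {mkM 1 0 (by decide)}) 2 ≤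
        ∑ e, term 2 oB (survivors oB {e}) 2 :=
      Finset.single_le_sum (f := fun e => term 2 oB (survivors oB {e}) 2)
        (fun e _ => term_nonneg _ _ _ _) (Finset.mem_univ _)
    have hv : term 2 oB (survivors oB {mkM 1 0 (by decide)}) 2 = 1 := by
      have hlt := survivors_card_lt oB (mkM 1 0 (by decide))
      have hb : Outcome.beats oB 1 0 = true := by simp [Outcome.beats, oB]
      have hsv := survivors_of_beats oB _ 1 0 (mkM_eq 1 0 (by decide)) hb
      have hm : (2 : Fin 3) ∈ survivors oB {mkM 1 0 (by decide)} := by rw [hsv]; simp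
      have h0 : (0 : Fin 3) ∉ survivors oB {mkM 1 0 (by decide)} := by rw [hsv]; simp
      rw [term, dif_pos hm]
      apply condorcet _ _ _ _ (by omega)
      intro j hj
      rw [beats_restrict]
      simp only [OrderIso.apply_symm_apply]
      have hjm := (Finset.orderIsoOfFin _ rfl j :
        {x // x ∈ survivors oB {mkM 1 0 (by decide)}}).2
      have hj2 : ((Finset.orderIsoOfFin _ rfl j :
          {x // x ∈ survivors oB {mkM 1 0 (by decide)}}) : Fin 3) ≠ 2 := by
        intro h
        apply hj
        rw [OrderIso.eq_symm_apply]
        exact Subtype.ext h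
      have hj0 : ((Finset.orderIsoOfFin _ rfl j :
          {x // x ∈ survivors oB {mkM 1 0 (by decide)}}) : Fin 3) ≠ 0 := by
        intro h
        rw [h] at hjm
        exact h0 hjm
      have hj1 : ((Finset.orderIsoOfFin _ rfl j :
          {x // x ∈ survivors oB {mkM 1 0 (by decide)}}) : Fin 3) = 1 := by
        revert hj2 hj0
        generalize ((Finset.orderIsoOfFin _ rfl j :
          {x // x ∈ survivors oB {mkM 1 0 (by decide)}}) : Fin 3) = x
        revert x
        decide
      rw [hj1]
      simp [Outcome.beats, oB]
    rw [hv] at hge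
    have : ((Nat.choose 3 2 : ℕ) : ℝ) = 3 := by norm_num [Nat.choose]
    rw [this]
    linarith
  unfold RDM
  linarith

theorem adj_AB : Adjacent {0, 1} (detT oB) (detT oA) := by
  intro i j h
  simp only [detT]
  have : Outcome.beats oB i j = Outcome.beats oA i j := by
    revert h
    revert i j
    simp only [Outcome.beats, oA, oB]
    decide
  rw [this]

end RDMProof

theorem stmt4 :
    (∀ (n : ℕ) (T T' : ProbTournament n) (u v : Fin n), u ≠ v →
      Adjacent {u, v} T T' → rPS RDM T' {u, v} - rPS RDM T {u, v} ≤ 1/3)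
    ∧ alph RDM 2 (WeaklyBounded (1/2)) = 1/3 := by
  refine ⟨RDMProof.part1, ?_⟩
  have hub : ∀ x ∈ {x : ℝ | ∃ (n : ℕ) (T T' : ProbTournament n) (S : Finset (Fin n)),
      WeaklyBounded (1/2) n T ∧ S.card ≤ 2 ∧ Adjacent S T T' ∧
        x = rPS RDM T' S - rPS RDM T S}, x ≤ 1/3 := by
    rintro x ⟨n, T, T', S, -, hS, hA, rfl⟩
    by_cases h2 : S.card = 2
    · obtain ⟨u, v, huv, rfl⟩ := Finset.card_eq_two.mp h2
      exact RDMProof.part1 n T T' u v huv hA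
    · have h1 : S.card ≤ 1 := by omega
      rw [Finset.card_le_one] at h1
      have hp : ∀ i j, i ≠ j → T.p i j = T'.p i j := by
        intro i j hij
        apply hA
        rintro ⟨hi, hj⟩
        exact hij (h1 i hi j hj)
      have hprob : ∀ o, T'.prob o = T.prob o := by
        intro o
        unfold ProbTournament.prob
        apply Finset.prod_congr rfl
        intro e _
        rw [hp _ _ e.2.ne, hp _ _ e.2.ne']
      have : rPS RDM T' S = rPS RDM T S := by
        unfold rPS rP
        simp_rw [hprob]
      rw [this]; norm_num
  apply le_antisymm
  · exact Real.sSup_le hub (by norm_num)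
  · have hmem : rPS RDM (RDMProof.detT RDMProof.oA) {0, 1} -
        rPS RDM (RDMProof.detT RDMProof.oB) {0, 1} ≤ alph RDM 2 (WeaklyBounded (1/2)) := by
      apply le_csSup ⟨1/3, hub⟩
      refine ⟨3, _, _, {0, 1}, ?_, ?_, RDMProof.adj_AB, rfl⟩
      · intro i j _
        have := (RDMProof.detT RDMProof.oB).mem_Icc i j
        norm_num at this ⊢
        exact this
      · exact Finset.card_le_two
    refine le_trans ?_ hmem
    have h01 : (0 : Fin 3) ≠ 1 := by decide
    rw [rPS, rPS, Finset.sum_pair h01, Finset.sum_pair h01]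
    simp only [RDMProof.detT_rP]
    have h1 := RDMProof.oA_win
    have h2 := RDMProof.oB_le
    have h3 : 0 ≤ RDM 3 RDMProof.oA 1 := RDMProof.RDMAux_nonneg _ _ _ _
    linarith
end

section
/- Randomized Single Elimination Bracket is 2-SNM-1/3, and this is tight: α₂^{RSEB}(𝒯^{1/2}) = 1/3. In particular, for every independent probabilistic tournament T, every pair of teams S = {u,v}, and every T' that is S-adjacent to T, RSEB_S(T') − RSEB_S(T) ≤ 1/3, and the supremum of such gains over all tournaments and pairs equals 1/3. -/
open scoped Classical
open Finset

/-! ## Statement -/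


namespace Pf

lemma beats_self {n : ℕ} (o : Outcome n) (i : Fin n) : Outcome.beats o i i = false := by
  simp [Outcome.beats]

lemma beats_symm {n : ℕ} (o : Outcome n) {i j : Fin n} (h : i ≠ j) :
    Outcome.beats o j i = !Outcome.beats o i j := by
  rcases lt_or_gt_of_ne h with h1 | h1
  · simp [Outcome.beats, h1, not_lt_of_gt h1]
  · simp [Outcome.beats, h1, not_lt_of_gt h1]

lemma beats_restrict {n : ℕ} (o : Outcome n) (s : Finset (Fin n)) (a b : Fin s.card) :
    Outcome.beats (restrictOutcome o s) a b =
      Outcome.beats o (↑(s.orderIsoOfFin rfl a)) (↑(s.orderIsoOfFin rfl b)) := by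
  rcases lt_trichotomy a b with h | h | h
  · simp [Outcome.beats, restrictOutcome, h]
  · subst h; rw [beats_self, beats_self]
  · have hne : (↑(s.orderIsoOfFin rfl b) : Fin n) ≠ ↑(s.orderIsoOfFin rfl a) := by
      intro h'
      have := (s.orderIsoOfFin rfl).injective (Subtype.coe_injective h')
      exact absurd this (ne_of_lt h)
    rw [beats_symm o hne]
    conv_lhs => rw [Outcome.beats]
    rw [dif_neg (not_lt_of_gt h), dif_pos h]
    rfl

lemma matchMem_comm {n : ℕ} {M : Finset (MatchPair n)} {x y : Fin n} :
    matchMem M x y ↔ matchMem M y x := by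
  unfold matchMem
  constructor <;> rintro ⟨e, he, h | h⟩ <;> exact ⟨e, he, by tauto⟩

lemma matchMem_ne {n : ℕ} {M : Finset (MatchPair n)} {x y : Fin n} (h : matchMem M x y) :
    x ≠ y := by
  obtain ⟨⟨⟨a, b⟩, hab⟩, he, h | h⟩ := h <;> simp only [Prod.mk.injEq] at h <;>
    obtain ⟨rfl, rfl⟩ := h
  · exact ne_of_lt hab
  · exact (ne_of_lt hab).symm

lemma losesIn_iff {n : ℕ} (o : Outcome n) (M : Finset (MatchPair n)) (i : Fin n) :
    losesIn o M i ↔ ∃ j, matchMem M i j ∧ Outcome.beats o j i = true := by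
  constructor
  · rintro ⟨⟨⟨a, b⟩, hab⟩, he, ⟨h, h'⟩ | ⟨h, h'⟩⟩
    · exact ⟨b, ⟨_, he, Or.inl (by simp at h; simp [h])⟩, h'⟩
    · exact ⟨a, ⟨_, he, Or.inr (by simp at h; simp [h])⟩, h'⟩
  · rintro ⟨j, ⟨⟨⟨a, b⟩, hab⟩, he, h | h⟩, h'⟩
    · simp only [Prod.mk.injEq] at h
      obtain ⟨rfl, rfl⟩ := h
      exact ⟨_, he, Or.inl ⟨rfl, h'⟩⟩
    · simp only [Prod.mk.injEq] at h
      obtain ⟨rfl, rfl⟩ := h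
      exact ⟨_, he, Or.inr ⟨rfl, h'⟩⟩

lemma mem_survivors {n : ℕ} (o : Outcome n) (M : Finset (MatchPair n)) (i : Fin n) :
    i ∈ survivors o M ↔ ∀ j, matchMem M i j → Outcome.beats o j i = false := by
  simp [survivors, losesIn_iff]

lemma isMatchingSet_iff {n : ℕ} (M : Finset (MatchPair n)) :
    IsMatchingSet M ↔ ∀ x y z, matchMem M x y → matchMem M x z → y = z := by
  constructor
  · rintro h x y z ⟨e, he, h1⟩ ⟨e', he', h2⟩
    obtain ⟨⟨a, b⟩, hab⟩ := e
    obtain ⟨⟨c, d⟩, hcd⟩ := e'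
    have h3 := h _ he _ he'
    simp only [Prod.mk.injEq, Subtype.mk.injEq, ne_eq] at h1 h2 h3
    have h4 := ne_of_lt hab
    have h5 := ne_of_lt hcd
    simp only at h4 h5
    grind
  · intro h e he e' he' hne
    obtain ⟨⟨a, b⟩, hab⟩ := e
    obtain ⟨⟨c, d⟩, hcd⟩ := e'
    have k1 : matchMem M a b := ⟨_, he, Or.inl rfl⟩
    have k2 : matchMem M c d := ⟨_, he', Or.inl rfl⟩
    have k1' := matchMem_comm.1 k1
    have k2' := matchMem_comm.1 k2
    simp only [Prod.mk.injEq, Subtype.mk.injEq, ne_eq] at hne hab hcd ⊢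
    refine ⟨?_, ?_, ?_, ?_⟩ <;> intro hh <;> subst hh
    · exact hne ⟨rfl, h _ _ _ k1 k2⟩
    · have := h _ _ _ k1 k2'
      subst this
      exact absurd hab (not_lt_of_gt hcd)
    · have := h _ _ _ k1' k2
      subst this
      exact absurd hab (not_lt_of_gt hcd)
    · exact hne ⟨h _ _ _ k1' k2', rfl⟩

/-- Action of a permutation of the teams on matches. -/
def mpMap {n : ℕ} (σ : Equiv.Perm (Fin n)) (e : MatchPair n) : MatchPair n :=
  if h : σ e.1.1 < σ e.1.2 then ⟨(σ e.1.1, σ e.1.2), h⟩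
  else ⟨(σ e.1.2, σ e.1.1), lt_of_le_of_ne (not_lt.1 h)
    (fun h' => (ne_of_lt e.2).symm (σ.injective h'))⟩

lemma mpMap_inv {n : ℕ} (σ τ : Equiv.Perm (Fin n)) (h : ∀ x, τ (σ x) = x) (e : MatchPair n) :
    mpMap τ (mpMap σ e) = e := by
  obtain ⟨⟨a, b⟩, hab⟩ := e
  have hab' : a < b := hab
  have hab2 := not_lt_of_gt hab'
  unfold mpMap
  by_cases h1 : σ a < σ b <;> simp [h1, h, hab', hab2]

/-- Action of a permutation of the teams on sets of matches. -/
noncomputable def mMap {n : ℕ} (σ : Equiv.Perm (Fin n)) (M : Finset (MatchPair n)) :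
    Finset (MatchPair n) := M.image (mpMap σ)

lemma mMap_inv {n : ℕ} (σ τ : Equiv.Perm (Fin n)) (h : ∀ x, τ (σ x) = x)
    (M : Finset (MatchPair n)) : mMap τ (mMap σ M) = M := by
  unfold mMap
  rw [Finset.image_image]
  have : mpMap τ ∘ mpMap σ = id := by
    funext e; exact mpMap_inv σ τ h e
  rw [this, Finset.image_id]

lemma matchMem_mMap' {n : ℕ} (σ : Equiv.Perm (Fin n)) (M : Finset (MatchPair n)) {x y : Fin n}
    (h : matchMem M x y) : matchMem (mMap σ M) (σ x) (σ y) := by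
  obtain ⟨e, he, h⟩ := h
  refine ⟨mpMap σ e, Finset.mem_image_of_mem _ he, ?_⟩
  obtain ⟨⟨a, b⟩, hab⟩ := e
  unfold mpMap
  by_cases h1 : σ a < σ b <;> simp only [Prod.mk.injEq, h1, dite_true, dite_false] at h ⊢ <;>
    rcases h with ⟨rfl, rfl⟩ | ⟨rfl, rfl⟩ <;> simp

lemma matchMem_mMap {n : ℕ} (σ : Equiv.Perm (Fin n)) (M : Finset (MatchPair n)) {x y : Fin n} :
    matchMem (mMap σ M) (σ x) (σ y) ↔ matchMem M x y := by
  refine ⟨fun h => ?_, matchMem_mMap' σ M⟩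
  have := matchMem_mMap' σ.symm _ h
  rwa [mMap_inv σ σ.symm (by simp), Equiv.symm_apply_apply, Equiv.symm_apply_apply] at this

/-- The set of matchings used by RSEB. -/
noncomputable def mset (n : ℕ) : Finset (Finset (MatchPair n)) :=
  Finset.univ.filter
    (fun M : Finset (MatchPair n) => IsMatchingSet M ∧ M.card = n / 2)

lemma mem_mset {n : ℕ} {M : Finset (MatchPair n)} :
    M ∈ mset n ↔ IsMatchingSet M ∧ M.card = n / 2 := by simp [mset]

lemma mMap_mem {n : ℕ} (σ : Equiv.Perm (Fin n)) {M : Finset (MatchPair n)} (h : M ∈ mset n) :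
    mMap σ M ∈ mset n := by
  rw [mem_mset] at h ⊢
  refine ⟨?_, ?_⟩
  · rw [isMatchingSet_iff] at h ⊢
    intro x y z
    obtain ⟨x, rfl⟩ := σ.surjective x
    obtain ⟨y, rfl⟩ := σ.surjective y
    obtain ⟨z, rfl⟩ := σ.surjective z
    rw [matchMem_mMap, matchMem_mMap]
    intro h1 h2
    rw [h.1 _ _ _ h1 h2]
  · rw [← h.2]
    apply Finset.card_image_of_injective
    intro a b hab
    rw [← mpMap_inv σ σ.symm (by simp) a, hab, mpMap_inv σ σ.symm (by simp) b]

lemma sum_mMap {n : ℕ} (σ : Equiv.Perm (Fin n)) (f : Finset (MatchPair n) → ℝ) :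
    ∑ M ∈ mset n, f (mMap σ M) = ∑ M ∈ mset n, f M := by
  refine Finset.sum_bij' (fun M _ => mMap σ M) (fun M _ => mMap σ.symm M) ?_ ?_ ?_ ?_ ?_
  · intro M h; exact mMap_mem σ h
  · intro M h; exact mMap_mem σ.symm h
  · intro M h; exact mMap_inv _ _ (by simp) M
  · intro M h; exact mMap_inv _ _ (by simp) M
  · intro M h; rfl

/-- Winning probability of `i` in the subtournament on `s`. -/
noncomputable def sub (fuel : ℕ) {n : ℕ} (o : Outcome n) (s : Finset (Fin n)) (i : Fin n) : ℝ :=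
  if h : i ∈ s then
    RSEBAux fuel s.card (restrictOutcome o s) ((s.orderIsoOfFin rfl).symm ⟨i, h⟩)
  else 0

lemma RSEBAux_succ (fuel n : ℕ) (o : Outcome n) (i : Fin n) (h : ¬ n ≤ 1) :
    RSEBAux (fuel + 1) n o i =
      ((mset n).card : ℝ)⁻¹ * ∑ M ∈ mset n, sub fuel o (survivors o M) i := by
  rw [RSEBAux, if_neg h]
  rfl

lemma RSEBAux_le (fuel n : ℕ) (o : Outcome n) (i : Fin n) (h : n ≤ 1) :
    RSEBAux fuel n o i = if n = 1 then 1 else 0 := by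
  cases fuel with
  | zero => rfl
  | succ k => rw [RSEBAux, if_pos h]

lemma RSEBAux_bd : ∀ (fuel n : ℕ) (o : Outcome n) (i : Fin n),
    0 ≤ RSEBAux fuel n o i ∧ RSEBAux fuel n o i ≤ 1 := by
  intro fuel
  induction fuel with
  | zero =>
    intro n o i
    simp only [RSEBAux]
    split_ifs <;> norm_num
  | succ k ih =>
    intro n o i
    by_cases hn : n ≤ 1
    · rw [RSEBAux_le _ _ _ _ hn]
      split_ifs <;> norm_num
    · rw [RSEBAux_succ _ _ _ _ hn]
      have h1 : ∀ M ∈ mset n, 0 ≤ sub k o (survivors o M) i := by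
        intro M _
        unfold sub
        split_ifs
        · exact (ih _ _ _).1
        · exact le_rfl
      have h2 : ∀ M ∈ mset n, sub k o (survivors o M) i ≤ 1 := by
        intro M _
        unfold sub
        split_ifs
        · exact (ih _ _ _).2
        · norm_num
      refine ⟨mul_nonneg (by positivity) (Finset.sum_nonneg h1), ?_⟩
      have h3 := Finset.sum_le_card_nsmul _ _ _ h2
      rw [nsmul_eq_mul, mul_one] at h3
      calc _ ≤ ((mset n).card : ℝ)⁻¹ * (mset n).card :=
            mul_le_mul_of_nonneg_left h3 (by positivity)
        _ ≤ 1 := inv_mul_le_one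

lemma sub_bd (fuel : ℕ) {n : ℕ} (o : Outcome n) (s : Finset (Fin n)) (i : Fin n) :
    0 ≤ sub fuel o s i ∧ sub fuel o s i ≤ 1 := by
  unfold sub
  split_ifs
  · exact RSEBAux_bd _ _ _ _
  · norm_num

/-- Transfer of a monotonicity statement to subtournaments. -/
lemma sub_mono (fuel : ℕ)
    (ih : ∀ (n m : ℕ) (σ : Fin n ≃ Fin m) (o : Outcome n) (o' : Outcome m) (i : Fin n),
      (∀ a b, a ≠ i → b ≠ i → Outcome.beats o a b = Outcome.beats o' (σ a) (σ b)) →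
      (∀ a, Outcome.beats o i a = true → Outcome.beats o' (σ i) (σ a) = true) →
      RSEBAux fuel n o i ≤ RSEBAux fuel m o' (σ i))
    {n : ℕ} (σ : Equiv.Perm (Fin n)) (o o' : Outcome n) (s s' : Finset (Fin n)) (i : Fin n)
    (hs : ∀ a, a ∈ s ↔ σ a ∈ s')
    (h1 : ∀ a ∈ s, ∀ b ∈ s, a ≠ i → b ≠ i →
      Outcome.beats o a b = Outcome.beats o' (σ a) (σ b))
    (h2 : ∀ a ∈ s, Outcome.beats o i a = true → Outcome.beats o' (σ i) (σ a) = true) :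
    sub fuel o s i ≤ sub fuel o' s' (σ i) := by
  by_cases hi : i ∈ s
  · have hi' : σ i ∈ s' := (hs i).1 hi
    unfold sub
    rw [dif_pos hi, dif_pos hi']
    let τ : Fin s.card ≃ Fin s'.card :=
      ((s.orderIsoOfFin rfl).toEquiv.trans (σ.subtypeEquiv hs)).trans
        (s'.orderIsoOfFin rfl).symm.toEquiv
    have hτ : ∀ a, (↑(s'.orderIsoOfFin rfl (τ a)) : Fin n) = σ ↑(s.orderIsoOfFin rfl a) := by
      intro a; simp [τ]
    have hi2 : (s'.orderIsoOfFin rfl).symm ⟨σ i, hi'⟩ =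
        τ ((s.orderIsoOfFin rfl).symm ⟨i, hi⟩) := by
      apply (s'.orderIsoOfFin rfl).injective
      apply Subtype.ext
      rw [hτ]; simp
    have hne : ∀ a, a ≠ (s.orderIsoOfFin rfl).symm ⟨i, hi⟩ →
        (↑(s.orderIsoOfFin rfl a) : Fin n) ≠ i := by
      intro a ha h
      apply ha
      apply (s.orderIsoOfFin rfl).injective
      apply Subtype.ext
      simpa using h
    rw [hi2]
    apply ih
    · intro a b ha hb
      rw [beats_restrict, beats_restrict, hτ, hτ]
      exact h1 _ (Subtype.prop _) _ (Subtype.prop _) (hne a ha) (hne b hb)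
    · intro a
      rw [beats_restrict, beats_restrict, hτ, hτ]
      simpa using h2 _ (Subtype.prop (s.orderIsoOfFin rfl a))
  · unfold sub
    rw [dif_neg hi]
    exact (sub_bd fuel o' s' (σ i)).1

lemma mono : ∀ (fuel n m : ℕ) (σ : Fin n ≃ Fin m) (o : Outcome n) (o' : Outcome m) (i : Fin n),
    (∀ a b, a ≠ i → b ≠ i → Outcome.beats o a b = Outcome.beats o' (σ a) (σ b)) →
    (∀ a, Outcome.beats o i a = true → Outcome.beats o' (σ i) (σ a) = true) →
    RSEBAux fuel n o i ≤ RSEBAux fuel m o' (σ i) := by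
  intro fuel
  induction fuel with
  | zero =>
    intro n m σ o o' i _ _
    have hnm : n = m := by simpa using Fintype.card_congr σ
    subst hnm
    exact le_rfl
  | succ k ih =>
    intro n m σ o o' i h1 h2
    have hnm : n = m := by simpa using Fintype.card_congr σ
    subst hnm
    by_cases hn : n ≤ 1
    · rw [RSEBAux_le _ _ _ _ hn, RSEBAux_le _ _ _ _ hn]
    rw [RSEBAux_succ _ _ _ _ hn, RSEBAux_succ _ _ _ _ hn]
    refine mul_le_mul_of_nonneg_left ?_ (by positivity)
    rw [← sum_mMap σ (fun M => sub k o' (survivors o' M) (σ i))]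
    refine Finset.sum_le_sum fun M _ => ?_
    by_cases hi : i ∈ survivors o M
    · have hib := (mem_survivors o M i).1 hi
      apply sub_mono k ih
      · intro a
        rw [mem_survivors, mem_survivors]
        have e1 : (∀ j, matchMem (mMap σ M) (σ a) j → Outcome.beats o' j (σ a) = false) ↔
            ∀ j, matchMem M a j → Outcome.beats o' (σ j) (σ a) = false := by
          constructor
          · intro h j hj; exact h _ ((matchMem_mMap σ M).2 hj)
          · intro h j
            obtain ⟨j, rfl⟩ := σ.surjective j
            intro hj; exact h _ ((matchMem_mMap σ M).1 hj)
        rw [e1]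
        refine forall_congr' fun j => imp_congr_right fun hj => ?_
        have hne := matchMem_ne hj
        by_cases ha : a = i
        · subst ha
          have e2 := hib j hj
          rw [beats_symm o hne] at e2
          rw [beats_symm o hne, beats_symm o' (σ.injective.ne hne)]
          have := h2 j (by simpa using e2)
          simp_all
        · by_cases hj' : j = i
          · subst hj'
            have e2 := hib a (matchMem_comm.1 hj)
            rw [beats_symm o hne.symm] at e2
            have e3 : Outcome.beats o j a = true := by simpa using e2
            rw [e3, h2 a e3]
          · rw [h1 j a hj' ha]
      · intro a _ b _ ha hb; exact h1 a b ha hb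
      · intro a _; exact h2 a
    · have : sub k o (survivors o M) i = 0 := dif_neg hi
      rw [this]
      exact (sub_bd _ _ _ _).1

lemma card_match_eq {n : ℕ} (a b c : Fin n) (hba : b ≠ a) (hca : c ≠ a) :
    ∑ M ∈ mset n, (if matchMem M a b then (1 : ℝ) else 0) =
    ∑ M ∈ mset n, (if matchMem M a c then (1 : ℝ) else 0) := by
  rw [← sum_mMap (Equiv.swap b c)]
  refine Finset.sum_congr rfl fun M _ => ?_
  have : matchMem (mMap (Equiv.swap b c) M) a b ↔ matchMem M a c := by
    have h := matchMem_mMap (Equiv.swap b c) M (x := a) (y := c)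
    rwa [Equiv.swap_apply_right, Equiv.swap_apply_of_ne_of_ne hba.symm hca.symm] at h
  simp only [this]

lemma card_match_comm {n : ℕ} (a b : Fin n) :
    ∑ M ∈ mset n, (if matchMem M a b then (1 : ℝ) else 0) =
    ∑ M ∈ mset n, (if matchMem M b a then (1 : ℝ) else 0) := by
  refine Finset.sum_congr rfl fun M _ => ?_
  simp only [matchMem_comm (x := a) (y := b)]

lemma main : ∀ (fuel n : ℕ) (o o' : Outcome n) (u v : Fin n),
    Outcome.beats o u v = true → Outcome.beats o' v u = true →
    (∀ a b, ¬(a = u ∧ b = v) → ¬(a = v ∧ b = u) →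
      Outcome.beats o a b = Outcome.beats o' a b) →
    (RSEBAux fuel n o u + RSEBAux fuel n o v - (RSEBAux fuel n o' u + RSEBAux fuel n o' v) ≤ 1/3)
    ∧ ((∀ w, ¬(Outcome.beats o u w = true ∧ Outcome.beats o w v = true)) →
      RSEBAux fuel n o u + RSEBAux fuel n o v
        - (RSEBAux fuel n o' u + RSEBAux fuel n o' v) ≤ 0) := by
  intro fuel
  induction fuel with
  | zero =>
    intro n o o' u v _ _ _
    simp only [RSEBAux]
    norm_num
  | succ k ih =>
    intro n o o' u v huv hvu hag
    by_cases hn : n ≤ 1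
    · simp only [RSEBAux_le _ _ _ _ hn]
      norm_num
    simp only [RSEBAux_succ _ _ _ _ hn]
    set N : ℝ := ((mset n).card : ℝ) with hN
    have hne : u ≠ v := by
      rintro rfl; rw [beats_self] at huv; exact absurd huv (by simp)
    let c : Finset (MatchPair n) → ℝ := fun M =>
      sub k o (survivors o M) u + sub k o (survivors o M) v
        - (sub k o' (survivors o' M) u + sub k o' (survivors o' M) v)
    have hD : N⁻¹ * ∑ M ∈ mset n, sub k o (survivors o M) u +
        N⁻¹ * ∑ M ∈ mset n, sub k o (survivors o M) v -
        (N⁻¹ * ∑ M ∈ mset n, sub k o' (survivors o' M) u +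
        N⁻¹ * ∑ M ∈ mset n, sub k o' (survivors o' M) v) = N⁻¹ * ∑ M ∈ mset n, c M := by
      simp only [c, Finset.sum_sub_distrib, Finset.sum_add_distrib]
      ring
    rw [hD]
    have hNn : 0 ≤ N⁻¹ := by positivity
    -- value when `u` and `v` are matched
    have huvM : ∀ M, matchMem M u v → c M =
        sub k o (survivors o M) u - sub k o' (survivors o' M) v := by
      intro M hM
      have e1 : v ∉ survivors o M := by
        rw [mem_survivors]; intro h
        have := h u (matchMem_comm.1 hM)
        rw [huv] at this; exact absurd this (by simp)
      have e2 : u ∉ survivors o' M := by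
        rw [mem_survivors]; intro h
        have := h v hM
        rw [hvu] at this; exact absurd this (by simp)
      have e3 : sub k o (survivors o M) v = 0 := dif_neg e1
      have e4 : sub k o' (survivors o' M) u = 0 := dif_neg e2
      simp only [c, e3, e4]; ring
    have hsurv : ∀ M, ¬ matchMem M u v → survivors o' M = survivors o M := by
      intro M hM
      ext a
      rw [mem_survivors, mem_survivors]
      refine forall_congr' fun j => imp_congr_right fun hj => ?_
      rw [hag j a]
      · rintro ⟨rfl, rfl⟩; exact hM (matchMem_comm.1 hj)
      · rintro ⟨rfl, rfl⟩; exact hM hj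
    -- value when they are not matched and not both survive
    have hzero : ∀ M, ¬ matchMem M u v → ¬ (u ∈ survivors o M ∧ v ∈ survivors o M) → c M = 0 := by
      intro M hM hs
      have hr : restrictOutcome o' (survivors o M) = restrictOutcome o (survivors o M) := by
        funext e
        unfold restrictOutcome
        rw [hag]
        · rintro ⟨h1, h2⟩
          exact hs ⟨h1 ▸ Subtype.prop _, h2 ▸ Subtype.prop _⟩
        · rintro ⟨h1, h2⟩
          exact hs ⟨h2 ▸ Subtype.prop _, h1 ▸ Subtype.prop _⟩
      simp only [c, hsurv M hM]
      unfold sub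
      rw [hr]; ring
    have hrec : ∀ M, ¬ matchMem M u v → c M ≤ 1/3 ∧
        ((∀ w ∈ survivors o M, ¬(Outcome.beats o u w = true ∧ Outcome.beats o w v = true)) →
          c M ≤ 0) := by
      intro M hM
      by_cases hs : u ∈ survivors o M ∧ v ∈ survivors o M
      · obtain ⟨hu, hv⟩ := hs
        have key := ih _ (restrictOutcome o (survivors o M)) (restrictOutcome o' (survivors o M))
          (((survivors o M).orderIsoOfFin rfl).symm ⟨u, hu⟩)
          (((survivors o M).orderIsoOfFin rfl).symm ⟨v, hv⟩)
          (by rw [beats_restrict]; simpa using huv) (by rw [beats_restrict]; simpa using hvu)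
          (by
            intro a b h1 h2
            rw [beats_restrict, beats_restrict]
            apply hag
            · rintro ⟨ha, hb⟩
              apply h1
              rw [OrderIso.eq_symm_apply, OrderIso.eq_symm_apply]
              exact ⟨Subtype.ext ha, Subtype.ext hb⟩
            · rintro ⟨ha, hb⟩
              apply h2
              rw [OrderIso.eq_symm_apply, OrderIso.eq_symm_apply]
              exact ⟨Subtype.ext ha, Subtype.ext hb⟩)
        simp only [c, hsurv M hM]
        unfold sub
        rw [dif_pos hu, dif_pos hv, dif_pos hu, dif_pos hv]
        refine ⟨key.1, fun hw => key.2 ?_⟩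
        intro w
        rw [beats_restrict, beats_restrict]
        simpa using hw _ (Subtype.prop ((survivors o M).orderIsoOfFin rfl w))
      · rw [hzero M hM hs]; norm_num
    have hnon : (∀ w, ¬(Outcome.beats o u w = true ∧ Outcome.beats o w v = true)) →
        ∀ M ∈ mset n, c M ≤ 0 := by
      intro hA M hM
      have hms := (isMatchingSet_iff M).1 (mem_mset.1 hM).1
      by_cases h1 : matchMem M u v
      · rw [huvM M h1, sub_nonpos]
        have h1' := matchMem_comm.1 h1
        have hus : u ∈ survivors o M := by
          rw [mem_survivors]; intro j hj
          rw [hms _ _ _ hj h1, beats_symm o hne, huv]; rfl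
        have hvs : v ∈ survivors o' M := by
          rw [mem_survivors]; intro j hj
          rw [hms _ _ _ hj h1', beats_symm o' hne.symm, hvu]; rfl
        have hvn : v ∉ survivors o M := by
          rw [mem_survivors]; intro h
          have := h u h1'
          rw [huv] at this; exact absurd this (by simp)
        have hun : u ∉ survivors o' M := by
          rw [mem_survivors]; intro h
          have := h v h1
          rw [hvu] at this; exact absurd this (by simp)
        have hsw : Equiv.swap u v u = v := Equiv.swap_apply_left u v
        have key := sub_mono k (mono k) (Equiv.swap u v) o o' (survivors o M) (survivors o' M) u
          (by
            intro a
            by_cases hau : a = u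
            · subst hau; rw [hsw]; exact iff_of_true hus hvs
            by_cases hav : a = v
            · subst hav; rw [Equiv.swap_apply_right]; exact iff_of_false hvn hun
            rw [Equiv.swap_apply_of_ne_of_ne hau hav, mem_survivors, mem_survivors]
            refine forall_congr' fun j => imp_congr_right fun hj => ?_
            rw [hag j a]
            · rintro ⟨_, h⟩; exact hav h
            · rintro ⟨_, h⟩; exact hau h)
          (by
            intro a ha b hb hau hbu
            have hav : a ≠ v := fun h => hvn (h ▸ ha)
            have hbv : b ≠ v := fun h => hvn (h ▸ hb)
            rw [Equiv.swap_apply_of_ne_of_ne hau hav, Equiv.swap_apply_of_ne_of_ne hbu hbv]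
            exact hag a b (fun h => hau h.1) (fun h => hav h.1))
          (by
            intro a ha hb
            have hav : a ≠ v := fun h => hvn (h ▸ ha)
            have hau : a ≠ u := by
              rintro rfl; rw [beats_self] at hb; exact absurd hb (by simp)
            rw [hsw, Equiv.swap_apply_of_ne_of_ne hau hav,
              ← hag v a (fun h => hav h.2) (fun h => hau h.2), beats_symm o hav]
            have := hA a
            simp only [hb, true_and, Bool.not_eq_true] at this
            rw [this]; rfl)
        rwa [hsw] at key
      · exact (hrec M h1).2 (fun w _ => hA w)
    have hnon2 : (∀ w, ¬(Outcome.beats o u w = true ∧ Outcome.beats o w v = true)) →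
        N⁻¹ * ∑ M ∈ mset n, c M ≤ 0 := fun hA =>
      mul_nonpos_of_nonneg_of_nonpos hNn (Finset.sum_nonpos (hnon hA))
    constructor
    · by_cases hA : ∃ w, Outcome.beats o u w = true ∧ Outcome.beats o w v = true
      · obtain ⟨w, hw1, hw2⟩ := hA
        have hwu : w ≠ u := by
          rintro rfl; rw [beats_self] at hw1; exact absurd hw1 (by simp)
        have hwv : w ≠ v := by
          rintro rfl; rw [beats_self] at hw2; exact absurd hw2 (by simp)
        -- two further families of matchings of nonpositive value
        have hvw : ∀ M ∈ mset n, ∀ w', w' ≠ u → w' ≠ v → Outcome.beats o w' v = true →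
            matchMem M v w' → c M ≤ 0 := by
          intro M hM w' hu' hv' hb hm
          have hms := (isMatchingSet_iff M).1 (mem_mset.1 hM).1
          have h1 : ¬ matchMem M u v := fun h => hu' (hms _ _ _ hm (matchMem_comm.1 h))
          refine (hzero M h1 ?_).le
          rintro ⟨_, h2⟩
          have := (mem_survivors _ _ _).1 h2 _ hm
          rw [hb] at this; exact absurd this (by simp)
        have hsum : ∃ P : Finset (MatchPair n) → Prop,
            (∀ M ∈ mset n, P M → c M ≤ 0) ∧
            (∀ M ∈ mset n, P M → ¬ matchMem M u v ∧ ¬ matchMem M v w) ∧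
            ∑ M ∈ mset n, (if P M then (1 : ℝ) else 0) =
              ∑ M ∈ mset n, (if matchMem M u v then (1 : ℝ) else 0) := by
          by_cases hA2 : ∃ w', w' ≠ w ∧ Outcome.beats o u w' = true ∧ Outcome.beats o w' v = true
          · obtain ⟨w', hww, hw1', hw2'⟩ := hA2
            have hwu' : w' ≠ u := by
              rintro rfl; rw [beats_self] at hw1'; exact absurd hw1' (by simp)
            have hwv' : w' ≠ v := by
              rintro rfl; rw [beats_self] at hw2'; exact absurd hw2' (by simp)
            refine ⟨fun M => matchMem M v w', fun M hM h => hvw M hM w' hwu' hwv' hw2' h, ?_, ?_⟩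
            · intro M hM h
              have hms := (isMatchingSet_iff M).1 (mem_mset.1 hM).1
              exact ⟨fun h' => hwu' (hms _ _ _ h (matchMem_comm.1 h')),
                fun h' => hww (hms _ _ _ h h')⟩
            · rw [card_match_comm u v]
              exact card_match_eq _ _ _ hwv' hne
          · refine ⟨fun M => matchMem M u w, ?_, ?_, ?_⟩
            · intro M hM h
              have hms := (isMatchingSet_iff M).1 (mem_mset.1 hM).1
              refine (hrec M (fun h' => hwv (hms _ _ _ h h'))).2 ?_
              intro x hx hxx
              apply hA2
              refine ⟨x, ?_, hxx⟩
              rintro rfl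
              have := (mem_survivors _ _ _).1 hx _ (matchMem_comm.1 h)
              rw [hw1] at this; exact absurd this (by simp)
            · intro M hM h
              have hms := (isMatchingSet_iff M).1 (mem_mset.1 hM).1
              exact ⟨fun h' => hwv (hms _ _ _ h h'),
                fun h' => hne (hms _ _ _ (matchMem_comm.1 h) (matchMem_comm.1 h'))⟩
            · exact card_match_eq _ _ _ hwu hne.symm
        obtain ⟨P, hP1, hP2, hP3⟩ := hsum
        have hQ : ∑ M ∈ mset n, (if matchMem M v w then (1 : ℝ) else 0) =
              ∑ M ∈ mset n, (if matchMem M u v then (1 : ℝ) else 0) := by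
          rw [card_match_comm u v]
          exact card_match_eq _ _ _ hwv hne
        have hpt : ∀ M ∈ mset n, c M ≤ 1/3 + 2/3 * (if matchMem M u v then (1 : ℝ) else 0)
            - 1/3 * (if matchMem M v w then (1 : ℝ) else 0)
            - 1/3 * (if P M then (1 : ℝ) else 0) := by
          intro M hM
          have hms := (isMatchingSet_iff M).1 (mem_mset.1 hM).1
          by_cases h1 : matchMem M u v
          · have h2 : ¬ matchMem M v w := fun h => hwu (hms _ _ _ h (matchMem_comm.1 h1))
            have h3 : ¬ P M := fun h => (hP2 M hM h).1 h1
            simp only [h1, h2, h3, if_true, if_false]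
            rw [huvM M h1]
            linarith [(sub_bd k o (survivors o M) u).2, (sub_bd k o' (survivors o' M) v).1]
          · by_cases h2 : matchMem M v w
            · have h3 : ¬ P M := fun h => (hP2 M hM h).2 h2
              simp only [h1, h2, h3, if_true, if_false]
              linarith [hvw M hM w hwu hwv hw2 h2]
            · by_cases h3 : P M
              · simp only [h1, h2, h3, if_true, if_false]
                linarith [hP1 M hM h3]
              · simp only [h1, h2, h3, if_false]
                linarith [(hrec M h1).1]
        have hfin := Finset.sum_le_sum hpt
        simp only [Finset.sum_sub_distrib, Finset.sum_add_distrib, ← Finset.mul_sum,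
          Finset.sum_const, nsmul_eq_mul] at hfin
        rw [hP3, hQ] at hfin
        have h5 : ∑ M ∈ mset n, c M ≤ N * (1/3) := by linarith
        calc N⁻¹ * ∑ M ∈ mset n, c M ≤ N⁻¹ * (N * (1/3)) := mul_le_mul_of_nonneg_left h5 hNn
          _ = (N⁻¹ * N) * (1/3) := by ring
          _ ≤ 1 * (1/3) := mul_le_mul_of_nonneg_right inv_mul_le_one (by norm_num)
          _ = 1/3 := by ring
      · exact (hnon2 (fun w hw => hA ⟨w, hw⟩)).trans (by norm_num)
    · exact hnon2

end Pf

namespace Pf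

lemma beats_extend {n : ℕ} (o : Outcome n) (a b : Fin (nextPow2 n)) (ha : (a : ℕ) < n)
    (hb : (b : ℕ) < n) :
    Outcome.beats (extendOutcome o) a b = Outcome.beats o ⟨a, ha⟩ ⟨b, hb⟩ := by
  rcases lt_trichotomy a b with h | h | h
  · have h' : (⟨a, ha⟩ : Fin n) < ⟨b, hb⟩ := h
    conv_lhs => rw [Outcome.beats]
    rw [dif_pos h]
    simp [extendOutcome, hb]
  · subst h; rw [beats_self, beats_self]
  · have h' : (⟨b, hb⟩ : Fin n) < ⟨a, ha⟩ := h
    rw [beats_symm o (ne_of_lt h')]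
    conv_lhs => rw [Outcome.beats]
    rw [dif_neg (not_lt_of_gt h), dif_pos h]
    simp [extendOutcome, ha]

lemma beats_extend_ge {n : ℕ} (o o' : Outcome n) (a b : Fin (nextPow2 n))
    (h : ¬ ((a : ℕ) < n ∧ (b : ℕ) < n)) :
    Outcome.beats (extendOutcome o) a b = Outcome.beats (extendOutcome o') a b := by
  unfold Outcome.beats
  by_cases h1 : a < b
  · have hb : ¬ (b : ℕ) < n := fun hb => h ⟨lt_trans (Fin.lt_def.mp h1) hb, hb⟩
    simp [h1, extendOutcome, hb]
  · by_cases h2 : b < a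
    · have hb : ¬ (a : ℕ) < n := fun hb => h ⟨hb, lt_trans (Fin.lt_def.mp h2) hb⟩
      simp [h1, h2, extendOutcome, hb]
    · simp [h1, h2]

lemma RSEB_main {n : ℕ} (o o' : Outcome n) (u v : Fin n)
    (huv : Outcome.beats o u v = true) (hvu : Outcome.beats o' v u = true)
    (hag : ∀ a b, ¬(a = u ∧ b = v) → ¬(a = v ∧ b = u) →
      Outcome.beats o a b = Outcome.beats o' a b) :
    RSEB n o u + RSEB n o v - (RSEB n o' u + RSEB n o' v) ≤ 1/3 := by
  unfold RSEB
  refine (main _ _ (extendOutcome o) (extendOutcome o') _ _ ?_ ?_ ?_).1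
  · rw [beats_extend o _ _ u.2 v.2]; exact huv
  · rw [beats_extend o' _ _ v.2 u.2]; exact hvu
  · intro a b h1 h2
    by_cases h : (a : ℕ) < n ∧ (b : ℕ) < n
    · rw [beats_extend o _ _ h.1 h.2, beats_extend o' _ _ h.1 h.2]
      apply hag
      · rintro ⟨ha, hb⟩
        apply h1
        rw [← ha, ← hb]; exact ⟨rfl, rfl⟩
      · rintro ⟨ha, hb⟩
        apply h2
        rw [← ha, ← hb]; exact ⟨rfl, rfl⟩
    · exact beats_extend_ge o o' a b h

/-- Flip the result of one match. -/
noncomputable def flip {n : ℕ} (e : MatchPair n) (o : Outcome n) : Outcome n :=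
  Function.update o e (!o e)

lemma flip_flip {n : ℕ} (e : MatchPair n) (o : Outcome n) : flip e (flip e o) = o := by
  simp [flip]

lemma flip_same {n : ℕ} (e : MatchPair n) (o : Outcome n) : flip e o e = !o e := by
  simp [flip]

lemma flip_ne {n : ℕ} (e e' : MatchPair n) (h : e' ≠ e) (o : Outcome n) :
    flip e o e' = o e' := by
  simp [flip, h]

lemma sum_flip {n : ℕ} (e : MatchPair n) (f : Outcome n → ℝ) :
    ∑ o, f (flip e o) = ∑ o, f o :=
  Equiv.sum_comp (⟨flip e, flip e, flip_flip e, flip_flip e⟩ : Outcome n ≃ Outcome n) f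

lemma gain_flip {n : ℕ} (o : Outcome n) (u v : Fin n) (huv : u < v) (x : Outcome n → ℝ)
    (hx : x = fun o => RSEB n o u + RSEB n o v) :
    x o - x (flip ⟨(u, v), huv⟩ o) ≤ 1/3 := by
  subst hx
  have hag : ∀ a b, ¬(a = u ∧ b = v) → ¬(a = v ∧ b = u) →
      Outcome.beats o a b = Outcome.beats (flip ⟨(u, v), huv⟩ o) a b := by
    intro a b h1 h2
    unfold Outcome.beats
    by_cases k1 : a < b
    · rw [dif_pos k1, dif_pos k1, flip_ne]
      intro h; simp at h; exact h1 h
    · rw [dif_neg k1, dif_neg k1]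
      by_cases k2 : b < a
      · rw [dif_pos k2, dif_pos k2, flip_ne]
        intro h; simp at h; exact h2 h.symm
      · rw [dif_neg k2, dif_neg k2]
  have b1 : ∀ o : Outcome n, Outcome.beats o u v = o ⟨(u, v), huv⟩ := by
    intro o; simp [Outcome.beats, huv]
  have b2 : ∀ o : Outcome n, Outcome.beats o v u = !o ⟨(u, v), huv⟩ := by
    intro o; rw [beats_symm o (ne_of_lt huv), b1]
  cases h : o ⟨(u, v), huv⟩
  · have := RSEB_main o (flip ⟨(u, v), huv⟩ o) v u (by rw [b2, h]; rfl)
      (by rw [b1, flip_same, h]; rfl) (fun a b h1 h2 => hag a b h2 h1)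
    simp only
    linarith
  · exact RSEB_main o (flip ⟨(u, v), huv⟩ o) u v (by rw [b1, h])
      (by rw [b2, flip_same, h]; rfl) hag

/-- Probability factor of one match. -/
noncomputable def fac {n : ℕ} (T : ProbTournament n) (e : MatchPair n) (b : Bool) : ℝ :=
  if b then T.p e.val.1 e.val.2 else T.p e.val.2 e.val.1

lemma fac_sum {n : ℕ} (T : ProbTournament n) (e : MatchPair n) (b : Bool) :
    fac T e b + fac T e (!b) = 1 := by
  have := T.compl e.val.1 e.val.2 (ne_of_lt e.2)
  cases b <;> simp [fac] <;> linarith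

lemma fac_nonneg {n : ℕ} (T : ProbTournament n) (e : MatchPair n) (b : Bool) :
    0 ≤ fac T e b := by
  unfold fac
  split_ifs
  · exact (T.mem_Icc _ _).1
  · exact (T.mem_Icc _ _).1

lemma prob_eq {n : ℕ} (T : ProbTournament n) (o : Outcome n) :
    T.prob o = ∏ e, fac T e (o e) := rfl

lemma prob_sum {n : ℕ} (T : ProbTournament n) : ∑ o, T.prob o = 1 := by
  simp only [prob_eq]
  have h := Finset.prod_univ_sum (fun _ : MatchPair n => (Finset.univ : Finset Bool))
    (fun e b => fac T e b)
  rw [Fintype.piFinset_univ] at h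
  rw [← h]
  apply Finset.prod_eq_one
  intro e _
  have := fac_sum T e true
  simpa using this

lemma prob_congr {n : ℕ} (T T' : ProbTournament n) (h : ∀ i j, i ≠ j → T.p i j = T'.p i j)
    (o : Outcome n) : T.prob o = T'.prob o := by
  unfold ProbTournament.prob
  refine Finset.prod_congr rfl fun e _ => ?_
  have := ne_of_lt e.2
  rw [h _ _ this, h _ _ this.symm]

lemma upper_lt {n : ℕ} (T T' : ProbTournament n) (u v : Fin n) (huv : u < v)
    (hadj : Adjacent {u, v} T T') :
    rPS RSEB T' {u, v} - rPS RSEB T {u, v} ≤ 1/3 := by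
  let e : MatchPair n := ⟨(u, v), huv⟩
  let g : Outcome n → ℝ := fun o => RSEB n o u + RSEB n o v
  have hS : ∀ T : ProbTournament n, rPS RSEB T {u, v} = ∑ o, T.prob o * g o := by
    intro T
    unfold rPS rP
    rw [Finset.sum_pair (ne_of_lt huv), ← Finset.sum_add_distrib]
    refine Finset.sum_congr rfl fun o _ => ?_
    simp only [g]; ring
  let Q : Outcome n → ℝ := fun o => ∏ e' ∈ Finset.univ.erase e, fac T e' (o e')
  have hQf : ∀ o, Q (flip e o) = Q o := by
    intro o
    refine Finset.prod_congr rfl fun e' he' => ?_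
    rw [flip_ne _ _ (Finset.ne_of_mem_erase he')]
  have hQ0 : ∀ o, 0 ≤ Q o := fun o => Finset.prod_nonneg fun e' _ => fac_nonneg _ _ _
  have hT : ∀ o, T.prob o = fac T e (o e) * Q o := by
    intro o
    rw [prob_eq, ← Finset.mul_prod_erase _ _ (Finset.mem_univ e)]
  have hfac : ∀ e' b, e' ≠ e → fac T' e' b = fac T e' b := by
    rintro ⟨⟨a, c⟩, hac⟩ b hne
    have hac' : a < c := hac
    have h1 : ¬ (a ∈ ({u, v} : Finset (Fin n)) ∧ c ∈ ({u, v} : Finset (Fin n))) := by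
      rintro ⟨h1, h2⟩
      simp only [Finset.mem_insert, Finset.mem_singleton] at h1 h2
      apply hne
      rcases h1 with rfl | rfl <;> rcases h2 with rfl | rfl
      · exact absurd hac' (lt_irrefl _)
      · rfl
      · exact absurd hac' (not_lt_of_gt huv)
      · exact absurd hac' (lt_irrefl _)
    unfold fac
    simp only
    rw [hadj a c h1, hadj c a (fun h => h1 h.symm)]
  have hT' : ∀ o, T'.prob o = fac T' e (o e) * Q o := by
    intro o
    rw [prob_eq, ← Finset.mul_prod_erase _ _ (Finset.mem_univ e)]
    congr 1
    refine Finset.prod_congr rfl fun e' he' => ?_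
    rw [hfac _ _ (Finset.ne_of_mem_erase he')]
  have hQsum : ∑ o, Q o = 2 := by
    have h1 := prob_sum T
    have h2 := sum_flip e T.prob
    have h3 : ∑ o, Q o = ∑ o, (T.prob o + T.prob (flip e o)) := by
      refine Finset.sum_congr rfl fun o _ => ?_
      rw [hT, hT, hQf, flip_same, ← add_mul, fac_sum, one_mul]
    rw [h3, Finset.sum_add_distrib, h2, h1]; norm_num
  let F : Outcome n → ℝ := fun o => (T'.prob o - T.prob o) * g o
  have hF : rPS RSEB T' {u, v} - rPS RSEB T {u, v} = ∑ o, F o := by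
    rw [hS, hS, ← Finset.sum_sub_distrib]
    refine Finset.sum_congr rfl fun o _ => ?_
    simp only [F]; ring
  have hpt : ∀ o, F o + F (flip e o) ≤ Q o * (1/3) := by
    intro o
    have h1 := fac_sum T e (o e)
    have h2 := fac_sum T' e (o e)
    have h3 := gain_flip o u v huv g rfl
    have h4 := gain_flip (flip e o) u v huv g rfl
    rw [show (⟨(u, v), huv⟩ : MatchPair n) = e from rfl] at h3 h4
    rw [flip_flip] at h4
    have n1 := fac_nonneg T e (o e)
    have n2 := fac_nonneg T' e (o e)
    have n3 := fac_nonneg T e (!o e)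
    have n4 := fac_nonneg T' e (!o e)
    have hE : F o + F (flip e o) =
        Q o * ((fac T' e (o e) - fac T e (o e)) * (g o - g (flip e o))) := by
      simp only [F, hT, hT', hQf, flip_same]
      have e1 : fac T e (!o e) = 1 - fac T e (o e) := by linarith
      have e2 : fac T' e (!o e) = 1 - fac T' e (o e) := by linarith
      rw [e1, e2]; ring
    rw [hE]
    refine mul_le_mul_of_nonneg_left ?_ (hQ0 o)
    have a1 : |fac T' e (o e) - fac T e (o e)| ≤ 1 := by rw [abs_le]; constructor <;> linarith
    have a2 : |g o - g (flip e o)| ≤ 1/3 := by rw [abs_le]; constructor <;> linarith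
    calc _ ≤ |(fac T' e (o e) - fac T e (o e)) * (g o - g (flip e o))| := le_abs_self _
      _ = |fac T' e (o e) - fac T e (o e)| * |g o - g (flip e o)| := abs_mul _ _
      _ ≤ 1 * (1/3) := mul_le_mul a1 a2 (abs_nonneg _) (by norm_num)
      _ = 1/3 := by ring
  have h5 := Finset.sum_le_sum (fun o (_ : o ∈ Finset.univ) => hpt o)
  rw [Finset.sum_add_distrib, sum_flip e F, ← Finset.sum_mul, hQsum] at h5
  rw [hF]; linarith

lemma upper {n : ℕ} (T T' : ProbTournament n) (u v : Fin n) (huv : u ≠ v)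
    (hadj : Adjacent {u, v} T T') :
    rPS RSEB T' {u, v} - rPS RSEB T {u, v} ≤ 1/3 := by
  rcases lt_or_gt_of_ne huv with h | h
  · exact upper_lt T T' u v h hadj
  · rw [Finset.pair_comm] at hadj ⊢
    exact upper_lt T T' v u h hadj

lemma upper_any {n : ℕ} (T T' : ProbTournament n) (S : Finset (Fin n)) (hS : S.card ≤ 2)
    (hadj : Adjacent S T T') : rPS RSEB T' S - rPS RSEB T S ≤ 1/3 := by
  by_cases h2 : S.card = 2
  · obtain ⟨u, v, huv, rfl⟩ := Finset.card_eq_two.1 h2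
    exact upper T T' u v huv hadj
  · have h1 : S.card ≤ 1 := by omega
    have h3 : ∀ o, T.prob o = T'.prob o := prob_congr T T' (fun i j hij => hadj i j
      (fun h => hij (Finset.card_le_one.1 h1 _ h.1 _ h.2)))
    unfold rPS rP
    simp only [h3]
    norm_num

/-- The deterministic tournament `o`, viewed as a probabilistic one. -/
noncomputable def det {n : ℕ} (o : Outcome n) : ProbTournament n where
  p i j := if Outcome.beats o i j then 1 else 0
  mem_Icc i j := by split_ifs <;> simp
  compl i j h := by rw [beats_symm o h]; cases Outcome.beats o i j <;> simp

lemma rP_det (r : ∀ n : ℕ, Outcome n → Fin n → ℝ) {n : ℕ} (o : Outcome n) (i : Fin n) :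
    rP r (det o) i = r n o i := by
  have hf : ∀ e b, fac (det o) e b = if o e = b then 1 else 0 := by
    rintro ⟨⟨a, c⟩, hac⟩ b
    have hac' : a < c := hac
    have e1 : Outcome.beats o a c = o ⟨(a, c), hac⟩ := by simp [Outcome.beats, hac']
    have e2 : Outcome.beats o c a = !o ⟨(a, c), hac⟩ := by rw [beats_symm o (ne_of_lt hac'), e1]
    unfold fac det
    simp only [e1, e2]
    cases b <;> cases o ⟨(a, c), hac⟩ <;> simp
  unfold rP
  rw [Finset.sum_eq_single o]
  · rw [prob_eq]; simp [hf]
  · intro o' _ hne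
    obtain ⟨e, he⟩ := Function.ne_iff.1 hne
    rw [prob_eq, Finset.prod_eq_zero (Finset.mem_univ e), zero_mul]
    rw [hf, if_neg he.symm]
  · simp

end Pf

namespace Pf

lemma RSEB4 (o : Outcome 4) (i : Fin 4) : RSEB 4 o i = RSEBAux 4 4 o i := by
  have h4 : nextPow2 4 = 4 := by
    unfold nextPow2
    have : Nat.clog 2 4 = 2 := by
      rw [show 4 = 2 ^ 2 by norm_num, Nat.clog_pow _ _ one_lt_two]
    rw [this]; norm_num
  unfold RSEB
  have key : ∀ a b : Fin 4, Outcome.beats o a b =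
      Outcome.beats (extendOutcome o) (finCongr h4.symm a) (finCongr h4.symm b) := by
    intro a b
    rw [beats_extend o (finCongr h4.symm a) (finCongr h4.symm b) a.2 b.2]
    rfl
  have h1 := mono (nextPow2 4) 4 (nextPow2 4) (finCongr h4.symm) o (extendOutcome o) i
    (fun a b _ _ => key a b) (fun a h => by rw [← key]; exact h)
  have h2 := mono (nextPow2 4) (nextPow2 4) 4 (finCongr h4) (extendOutcome o) o
    (finCongr h4.symm i)
    (fun a b _ _ => (key (finCongr h4 a) (finCongr h4 b)).symm)
    (fun a h => (key i (finCongr h4 a)).trans h)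
  have h3 := le_antisymm h1 h2
  rw [show RSEBAux (nextPow2 4) 4 o i = RSEBAux 4 4 o i by rw [h4]] at h3
  exact h3.symm

lemma mset2 : mset 2 = {Finset.univ} := by
  ext M
  rw [mem_mset, Finset.mem_singleton]
  have hc : Fintype.card (MatchPair 2) = 1 := by decide
  have hsub : ∀ e e' : MatchPair 2, e = e' := Fintype.card_le_one_iff.1 hc.le
  constructor
  · rintro ⟨_, h⟩
    rw [← Finset.card_eq_iff_eq_univ, hc, h]
  · rintro rfl
    refine ⟨fun e _ e' _ hne => absurd (hsub e e') hne, ?_⟩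
    rw [Finset.card_univ, hc]

lemma matchMem_univ {n : ℕ} {i j : Fin n} (h : i ≠ j) : matchMem Finset.univ i j := by
  rcases lt_or_gt_of_ne h with h | h
  · exact ⟨⟨(i, j), h⟩, Finset.mem_univ _, Or.inl rfl⟩
  · exact ⟨⟨(j, i), h⟩, Finset.mem_univ _, Or.inr rfl⟩

lemma two (fuel n : ℕ) (hn : n = 2) (o : Outcome n) (i j : Fin n)
    (h : Outcome.beats o i j = true) :
    RSEBAux (fuel + 1) n o i = 1 ∧ RSEBAux (fuel + 1) n o j = 0 := by
  subst hn
  have hne : i ≠ j := by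
    rintro rfl; rw [beats_self] at h; exact absurd h (by simp)
  have hc : ∀ k : Fin 2, k = i ∨ k = j := by
    revert hne; clear h; revert i j; decide
  have hs : survivors o Finset.univ = {i} := by
    ext k
    rw [mem_survivors, Finset.mem_singleton]
    constructor
    · intro hk
      rcases hc k with h1 | h1
      · exact h1
      · subst h1
        have := hk i (matchMem_univ hne.symm)
        rw [h] at this; exact absurd this (by simp)
    · rintro rfl l hl
      rcases hc l with h1 | h1
      · exact absurd h1.symm (matchMem_ne hl)
      · subst h1; rw [beats_symm o hne, h]; rfl
  rw [RSEBAux_succ _ _ _ _ (by norm_num), RSEBAux_succ _ _ _ _ (by norm_num), mset2]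
  simp only [Finset.sum_singleton, hs, Finset.card_singleton, Nat.cast_one, inv_one, one_mul]
  constructor
  · unfold sub
    rw [dif_pos (Finset.mem_singleton_self i), RSEBAux_le _ _ _ _ (by simp)]
    simp
  · exact dif_neg (by simpa using hne.symm)

lemma sub_pair (fuel : ℕ) {n : ℕ} (o : Outcome n) (s : Finset (Fin n)) (i j : Fin n)
    (hs : s = {i, j}) (h : Outcome.beats o i j = true) :
    sub (fuel + 1) o s i = 1 ∧ sub (fuel + 1) o s j = 0 := by
  have hne : i ≠ j := by
    rintro rfl; rw [beats_self] at h; exact absurd h (by simp)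
  have hi : i ∈ s := by simp [hs]
  have hj : j ∈ s := by simp [hs]
  unfold sub
  rw [dif_pos hi, dif_pos hj]
  apply two
  · rw [hs]; exact Finset.card_pair hne
  · rw [beats_restrict]; simpa using h

/-- First example outcome: team 0 beats everyone. -/
def o1 : Outcome 4 := fun e => decide (e.val ≠ (1, 2))

/-- Second example outcome: team 1 beats team 0 instead. -/
def o2 : Outcome 4 := fun e => decide (e.val ≠ (1, 2) ∧ e.val ≠ (0, 1))

def M1 : Finset (MatchPair 4) := {⟨(0, 1), by decide⟩, ⟨(2, 3), by decide⟩}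
def M2 : Finset (MatchPair 4) := {⟨(0, 2), by decide⟩, ⟨(1, 3), by decide⟩}
def M3 : Finset (MatchPair 4) := {⟨(0, 3), by decide⟩, ⟨(1, 2), by decide⟩}

set_option maxRecDepth 100000 in
lemma mset4 : mset 4 = {M1, M2, M3} := by
  ext M
  rw [mem_mset, Finset.mem_insert, Finset.mem_insert, Finset.mem_singleton]
  constructor
  · rintro ⟨h, hc⟩
    obtain ⟨e, e', hne, rfl⟩ := Finset.card_eq_two.1 hc
    have h1 := h e (by simp) e' (by simp) hne
    have key : ∀ e e' : MatchPair 4, e.val.1 ≠ e'.val.1 → e.val.1 ≠ e'.val.2 →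
        e.val.2 ≠ e'.val.1 → e.val.2 ≠ e'.val.2 →
        (e.val = (0, 1) ∧ e'.val = (2, 3) ∨ e'.val = (0, 1) ∧ e.val = (2, 3)) ∨
        (e.val = (0, 2) ∧ e'.val = (1, 3) ∨ e'.val = (0, 2) ∧ e.val = (1, 3)) ∨
        (e.val = (0, 3) ∧ e'.val = (1, 2) ∨ e'.val = (0, 3) ∧ e.val = (1, 2)) := by decide
    have h2 := key e e' h1.1 h1.2.1 h1.2.2.1 h1.2.2.2
    obtain ⟨q, hq⟩ := e
    obtain ⟨q', hq'⟩ := e'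
    simp only at h2
    rcases h2 with (⟨rfl, rfl⟩ | ⟨rfl, rfl⟩) | (⟨rfl, rfl⟩ | ⟨rfl, rfl⟩) |
      (⟨rfl, rfl⟩ | ⟨rfl, rfl⟩)
    · left; ext x; simp [M1]
    · left; ext x; simp [M1, or_comm]
    · right; left; ext x; simp [M2]
    · right; left; ext x; simp [M2, or_comm]
    · right; right; ext x; simp [M3]
    · right; right; ext x; simp [M3, or_comm]
  · unfold IsMatchingSet
    rintro (rfl | rfl | rfl)
    · exact ⟨by decide, by decide⟩
    · exact ⟨by decide, by decide⟩
    · exact ⟨by decide, by decide⟩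

lemma M_ne : M1 ≠ M2 ∧ M1 ≠ M3 ∧ M2 ≠ M3 := by decide

lemma surv_eq {n : ℕ} (o : Outcome n) (M : Finset (MatchPair n)) (s : Finset (Fin n))
    (h : ∀ i, i ∈ s ↔ ¬ ∃ e ∈ M, (e.val.1 = i ∧ Outcome.beats o e.val.2 i = true) ∨
           (e.val.2 = i ∧ Outcome.beats o e.val.1 i = true)) : survivors o M = s := by
  ext i
  rw [h i]
  simp only [survivors, Finset.mem_filter, Finset.mem_univ, true_and]
  rfl

lemma s11 : survivors o1 M1 = {0, 2} := surv_eq _ _ _ (by decide)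
lemma s12 : survivors o1 M2 = {0, 1} := surv_eq _ _ _ (by decide)
lemma s13 : survivors o1 M3 = {0, 2} := surv_eq _ _ _ (by decide)
lemma s21 : survivors o2 M1 = {2, 1} := surv_eq _ _ _ (by decide)
lemma s22 : survivors o2 M2 = {1, 0} := surv_eq _ _ _ (by decide)
lemma s23 : survivors o2 M3 = {0, 2} := surv_eq _ _ _ (by decide)

lemma RSEB4_eq (o : Outcome 4) (i : Fin 4) : RSEB 4 o i =
    (1/3) * (sub 3 o (survivors o M1) i + sub 3 o (survivors o M2) i
      + sub 3 o (survivors o M3) i) := by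
  rw [RSEB4, RSEBAux_succ _ _ _ _ (by norm_num), mset4]
  obtain ⟨h1, h2, h3⟩ := M_ne
  rw [Finset.sum_insert (by simp [h1, h2]), Finset.sum_insert (by simp [h3]),
    Finset.sum_singleton, Finset.card_insert_of_notMem (by simp [h1, h2]),
    Finset.card_insert_of_notMem (by simp [h3]), Finset.card_singleton]
  push_cast
  ring

lemma gain : RSEB 4 o1 0 + RSEB 4 o1 1 - (RSEB 4 o2 0 + RSEB 4 o2 1) ≥ 1/3 := by
  simp only [RSEB4_eq]
  have a1 := (sub_pair 2 o1 _ 0 2 s11 (by decide)).1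
  have a2 := (sub_pair 2 o1 _ 0 1 s12 (by decide)).1
  have a3 := (sub_pair 2 o1 _ 0 2 s13 (by decide)).1
  have b1 := (sub_pair 2 o2 _ 2 1 s21 (by decide)).2
  have b2 := (sub_pair 2 o2 _ 1 0 s22 (by decide)).2
  have b3 : sub 3 o2 (survivors o2 M1) 0 = 0 := dif_neg (by rw [s21]; decide)
  have b4 : sub 3 o2 (survivors o2 M3) 1 = 0 := dif_neg (by rw [s23]; decide)
  have c1 := (sub_bd 3 o1 (survivors o1 M1) 1).1
  have c2 := (sub_bd 3 o1 (survivors o1 M2) 1).1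
  have c3 := (sub_bd 3 o1 (survivors o1 M3) 1).1
  have d2 := (sub_bd 3 o2 (survivors o2 M2) 1).2
  have d3 := (sub_bd 3 o2 (survivors o2 M3) 0).2
  norm_num at a1 a2 a3 b1 b2
  rw [a1, a2, a3, b1, b2, b3, b4]
  linarith

lemma o_agree : ∀ i j : Fin 4, ¬(i ∈ ({0, 1} : Finset (Fin 4)) ∧ j ∈ ({0, 1} : Finset (Fin 4))) →
    Outcome.beats o2 i j = Outcome.beats o1 i j := by decide

lemma alph_eq : alph RSEB 2 (WeaklyBounded (1/2)) = 1/3 := by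
  have hub : ∀ x ∈ {x : ℝ | ∃ (n : ℕ) (T T' : ProbTournament n) (S : Finset (Fin n)),
      WeaklyBounded (1/2) n T ∧ S.card ≤ 2 ∧ Adjacent S T T' ∧
        x = rPS RSEB T' S - rPS RSEB T S}, x ≤ 1/3 := by
    rintro x ⟨n, T, T', S, _, hS, hadj, rfl⟩
    exact upper_any T T' S hS hadj
  have hmem : rPS RSEB (det o1) {0, 1} - rPS RSEB (det o2) {0, 1} ∈
      {x : ℝ | ∃ (n : ℕ) (T T' : ProbTournament n) (S : Finset (Fin n)),
      WeaklyBounded (1/2) n T ∧ S.card ≤ 2 ∧ Adjacent S T T' ∧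
        x = rPS RSEB T' S - rPS RSEB T S} := by
    refine ⟨4, det o2, det o1, {0, 1}, ?_, by decide, ?_, rfl⟩
    · intro i j _
      have := (det o2).mem_Icc i j
      norm_num at this ⊢
      exact this
    · intro i j h
      simp only [det, o_agree i j h]
  have hg : (1/3 : ℝ) ≤ rPS RSEB (det o1) {0, 1} - rPS RSEB (det o2) {0, 1} := by
    unfold rPS
    rw [Finset.sum_pair (by decide), Finset.sum_pair (by decide)]
    simp only [rP_det]
    exact gain
  unfold alph
  apply le_antisymm
  · exact csSup_le ⟨_, hmem⟩ hub
  · exact hg.trans (le_csSup ⟨1/3, hub⟩ hmem)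

end Pf

theorem stmt5 :
    (∀ (n : ℕ) (T T' : ProbTournament n) (u v : Fin n), u ≠ v →
      Adjacent {u, v} T T' → rPS RSEB T' {u, v} - rPS RSEB T {u, v} ≤ 1/3)
    ∧ alph RSEB 2 (WeaklyBounded (1/2)) = 1/3 := by
  exact ⟨fun _ T T' u v huv hadj => Pf.upper T T' u v huv hadj, Pf.alph_eq⟩
end
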